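/- arXiv:math/0002197 — 2 statements merged into one kernel-verified Lean document; each statement's English description precedes it below -/
import Mathlib

section
/- Let the holomorphic completely overdetermined second order system (S_F) be involutive. If (θ, η) is an infinitesimal symmetry of (S_F) whose initial data ω(p) vanishes at some point p ∈ U, then θ ≡ 0 and η ≡ 0 on U. Consequently, for each fixed p ∈ U, the linear map sending an infinitesimal symmetry (θ, η) of (S_F) to its initial data ω(p) ∈ ℂ^{(n+m+2)(n+m)} is injective. -/
open scoped BigOperators

noncomputable section

/-- The space of independent and dependent variables `(x, u) ∈ ℂⁿ × ℂᵐ`. -/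
abbrev Wsp (n m : ℕ) := (Fin n → ℂ) × (Fin m → ℂ)

/-- The space of first-order jet variables `q = (q_i^k)`, with `q k i` standing for
`∂u^k/∂x_i`. -/
abbrev Jsp (n m : ℕ) := Fin m → Fin n → ℂ

/-- The first-order jet space `ℂⁿ × ℂᵐ × ℂ^{mn}` with coordinates `(x, u, q)`. -/
abbrev Psp (n m : ℕ) := Wsp n m × Jsp n m

/-- Coordinate direction `∂/∂x_i` in the jet space. -/
def dirx (n m : ℕ) (i : Fin n) : Psp n m := (((Pi.single i 1 : Fin n → ℂ), 0), 0)

/-- Coordinate direction `∂/∂u^k` in the jet space. -/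
def diru (n m : ℕ) (k : Fin m) : Psp n m := ((0, (Pi.single k 1 : Fin m → ℂ)), 0)

/-- Coordinate direction `∂/∂q_j^k` in the jet space. -/
def dirq (n m : ℕ) (k : Fin m) (j : Fin n) : Psp n m :=
  ((0, 0), (Pi.single k (Pi.single j 1) : Fin m → Fin n → ℂ))

/-- The total derivative `D_i` applied to a function `ψ(x, u)` of the base
variables only: `D_i ψ = ∂ψ/∂x_i + Σ_k q_i^k ∂ψ/∂u^k`. -/
def Dtot {n m : ℕ} (ψ : Wsp n m → ℂ) (i : Fin n) (p : Psp n m) : ℂ :=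
  fderiv ℂ ψ p.1 ((Pi.single i 1 : Fin n → ℂ), 0)
    + ∑ k, p.2 k i * fderiv ℂ ψ p.1 (0, (Pi.single k 1 : Fin m → ℂ))

/-- The total derivative `D_i^F` of the system `(S_F)` applied to a function
`φ(x, u, q)`: `D_i^F φ = ∂φ/∂x_i + Σ_k q_i^k ∂φ/∂u^k + Σ_{k,j} F_{ij}^k ∂φ/∂q_j^k`. -/
def DtotF {n m : ℕ} (F : Fin n → Fin n → Fin m → Psp n m → ℂ)
    (φ : Psp n m → ℂ) (i : Fin n) (p : Psp n m) : ℂ :=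
  fderiv ℂ φ p (dirx n m i) + ∑ k, p.2 k i * fderiv ℂ φ p (diru n m k)
    + ∑ k, ∑ j, F i j k p * fderiv ℂ φ p (dirq n m k j)

/-- The first prolongation coefficient `η_i^μ = D_i η^μ − Σ_j (D_i θ_j) q_j^μ`. -/
def eta1 {n m : ℕ} (θ : Fin n → Wsp n m → ℂ) (η : Fin m → Wsp n m → ℂ)
    (μ : Fin m) (i : Fin n) (p : Psp n m) : ℂ :=
  Dtot (η μ) i p - ∑ j, Dtot (θ j) i p * p.2 μ j

/-- The second prolongation coefficient `η_{ij}^μ = D_j^F η_i^μ − Σ_k (D_j θ_k) F_{ik}^μ`. -/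
def eta2 {n m : ℕ} (F : Fin n → Fin n → Fin m → Psp n m → ℂ)
    (θ : Fin n → Wsp n m → ℂ) (η : Fin m → Wsp n m → ℂ)
    (μ : Fin m) (i j : Fin n) (p : Psp n m) : ℂ :=
  DtotF F (eta1 θ η μ i) j p - ∑ k, Dtot (θ k) j p * F i k μ p

/-- The pair `(θ, η)` is an infinitesimal symmetry of the system `(S_F)` on `U × Q`:
the determining identity
`η_{ij}^μ = Σ_s θ_s ∂F_{ij}^μ/∂x_s + Σ_k η^k ∂F_{ij}^μ/∂u^k + Σ_{k,l} η_l^k ∂F_{ij}^μ/∂q_l^k`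
holds identically on `U × Q` for all `i, j, μ`. -/
def IsSymmetry {n m : ℕ} (U : Set (Wsp n m)) (Q : Set (Jsp n m))
    (F : Fin n → Fin n → Fin m → Psp n m → ℂ)
    (θ : Fin n → Wsp n m → ℂ) (η : Fin m → Wsp n m → ℂ) : Prop :=
  ∀ p ∈ U ×ˢ Q, ∀ (i j : Fin n) (μ : Fin m),
    eta2 F θ η μ i j p =
      (∑ s, θ s p.1 * fderiv ℂ (F i j μ) p (dirx n m s))
      + (∑ k, η k p.1 * fderiv ℂ (F i j μ) p (diru n m k))
      + (∑ k, ∑ l, eta1 θ η k l p * fderiv ℂ (F i j μ) p (dirq n m k l))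

/-- The vector field `Z_i = ∂/∂x_i + Σ_k q_i^k ∂/∂u^k + Σ_{k,j} F_{ij}^k ∂/∂q_j^k`
on the jet space. -/
def Zfield {n m : ℕ} (F : Fin n → Fin n → Fin m → Psp n m → ℂ) (i : Fin n)
    (p : Psp n m) : Psp n m :=
  dirx n m i + (∑ k, p.2 k i • diru n m k) + ∑ k, ∑ j, F i j k p • dirq n m k j

/-- The system `(S_F)` is involutive: the fields `Z_i` pairwise commute on `U × Q`. -/
def IsInvolutive {n m : ℕ} (U : Set (Wsp n m)) (Q : Set (Jsp n m))
    (F : Fin n → Fin n → Fin m → Psp n m → ℂ) : Prop :=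
  ∀ p ∈ U ×ˢ Q, ∀ i j : Fin n,
    fderiv ℂ (Zfield F j) p (Zfield F i p) = fderiv ℂ (Zfield F i) p (Zfield F j p)

/-- Coordinate directions in the `(x, u)`-space, indexed by `w = (w_1, …, w_{n+m})`. -/
def dirw (n m : ℕ) : Fin n ⊕ Fin m → Wsp n m
  | Sum.inl i => ((Pi.single i 1 : Fin n → ℂ), 0)
  | Sum.inr k => (0, (Pi.single k 1 : Fin m → ℂ))

open Metric Set Filter Topology


section Hol
set_option linter.unusedSectionVars false
variable {E G : Type*} [NormedAddCommGroup E] [NormedSpace ℂ E] [FiniteDimensional ℂ E]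
  [NormedAddCommGroup G] [NormedSpace ℂ G] [FiniteDimensional ℂ G]

theorem hol_fderiv_bound {f : E → G} {w₀ y : E} {R : ℝ} (hR : 0 < R)
    (hf : DifferentiableOn ℂ f (ball w₀ R))
    (hb : ∀ w ∈ ball w₀ R, ‖f w - f w₀‖ ≤ 1) (hy : y ∈ ball w₀ (R/2)) :
    ‖fderiv ℂ f y‖ ≤ 2 / (R/2) := by
  have hsub : ball y (R/2) ⊆ ball w₀ R := by
    apply ball_subset_ball'
    rw [mem_ball] at hy; linarith
  apply Complex.norm_fderiv_le_div_of_mapsTo_ball (hf.mono hsub) _ (by positivity)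
  intro z hz
  have h1 := hb z (hsub hz)
  have h2 := hb y (hsub (mem_ball_self (by positivity)))
  rw [mem_closedBall, dist_eq_norm]
  calc ‖f z - f y‖ = ‖(f z - f w₀) - (f y - f w₀)‖ := by congr 1; abel
    _ ≤ _ := norm_sub_le _ _
    _ ≤ 2 := by linarith

theorem hol_pd {f : E → G} {U : Set E} (hU : IsOpen U) (hf : DifferentiableOn ℂ f U) (v : E) :
    DifferentiableOn ℂ (fun w => fderiv ℂ f w v) U := by
  intro w₀ hw₀
  apply DifferentiableAt.differentiableWithinAt
  have : CompleteSpace G := FiniteDimensional.complete ℂ G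
  -- choose R
  obtain ⟨R, hR, hRU, hb⟩ : ∃ R > 0, ball w₀ R ⊆ U ∧ ∀ w ∈ ball w₀ R, ‖f w - f w₀‖ ≤ 1 := by
    have h1 : ∀ᶠ w in 𝓝 w₀, w ∈ U := hU.mem_nhds hw₀
    have hc : ContinuousAt f w₀ := (hf.differentiableAt (hU.mem_nhds hw₀)).continuousAt
    have h2 : ∀ᶠ w in 𝓝 w₀, ‖f w - f w₀‖ ≤ 1 := by
      have := hc.eventually (ball_mem_nhds (f w₀) one_pos)
      filter_upwards [this] with w hw
      rw [← dist_eq_norm]; exact le_of_lt hw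
    obtain ⟨R, hR, h⟩ := Metric.eventually_nhds_iff_ball.1 (h1.and h2)
    exact ⟨R, hR, fun w hw => (h w hw).1, fun w hw => (h w hw).2⟩
  have hfR := hf.mono hRU
  set ρ : ℝ := R / (4 * (‖v‖ + 1)) with hρ
  have hv : 0 ≤ ‖v‖ := norm_nonneg v
  have hρ0 : 0 < ρ := by positivity
  have hρv : ρ * ‖v‖ ≤ R / 4 := by
    rw [hρ, div_mul_eq_mul_div, div_le_div_iff₀ (by positivity) (by positivity)]
    nlinarith
  have hin : ∀ w ∈ ball w₀ (R/4), ∀ z ∈ closedBall (0:ℂ) ρ, w + z • v ∈ ball w₀ (R/2) := by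
    intro w hw z hz
    rw [mem_ball, dist_eq_norm] at *
    rw [mem_closedBall, dist_zero_right] at hz
    calc ‖w + z • v - w₀‖ = ‖(w - w₀) + z • v‖ := by congr 1; abel
      _ ≤ ‖w - w₀‖ + ‖z‖ * ‖v‖ := by rw [← norm_smul]; exact norm_add_le _ _
      _ < R / 2 := by nlinarith
  have hhalf : ball w₀ (R/2) ⊆ ball w₀ R := ball_subset_ball (by linarith)
  have hdat : ∀ y ∈ ball w₀ (R/2), DifferentiableAt ℂ f y := fun y hy =>
    hfR.differentiableAt (isOpen_ball.mem_nhds (hhalf hy))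
  -- Cauchy formula
  have hcauchy : ∀ w ∈ ball w₀ (R/4), fderiv ℂ f w v =
      (2 * Real.pi * Complex.I : ℂ)⁻¹ • ∮ z in C(0, ρ), (1 / (z - 0) ^ 2) • f (w + z • v) := by
    intro w hw
    have hd : ∀ z ∈ closedBall (0:ℂ) ρ, DifferentiableAt ℂ (fun z : ℂ => f (w + z • v)) z := by
      intro z hz
      exact (hdat _ (hin w hw z hz)).comp z (f := fun z : ℂ => w + z • v) (by fun_prop)
    rw [DifferentiableOn.deriv_eq_smul_circleIntegral (f := fun z : ℂ => f (w + z • v)) hρ0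
      (fun z hz => (hd z hz).differentiableWithinAt), inv_smul_smul₀ Complex.two_pi_I_ne_zero]
    have h0 : w + (0:ℂ) • v ∈ ball w₀ (R/2) := hin w hw 0 (by simp [hρ0.le])
    have h1 : HasFDerivAt f (fderiv ℂ f w) (w + (0:ℂ) • v) := by
      have := (hdat _ h0).hasFDerivAt
      simpa using this
    have h2 : HasDerivAt (fun z : ℂ => w + z • v) v 0 := by
      simpa using ((hasDerivAt_id (0:ℂ)).smul_const v).const_add w
    exact ((h1.comp_hasDerivAt (0:ℂ) h2).deriv).symm
  have hnhds : ball w₀ (R/4) ∈ 𝓝 w₀ := ball_mem_nhds _ (by positivity)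
  have hev : (fun w => fderiv ℂ f w v) =ᶠ[𝓝 w₀] fun w => (2 * Real.pi * Complex.I : ℂ)⁻¹ •
      ∮ z in C(0, ρ), (1 / (z - 0) ^ 2) • f (w + z • v) := by
    filter_upwards [hnhds] with w hw using hcauchy w hw
  refine DifferentiableAt.congr_of_eventuallyEq ?_ hev
  apply DifferentiableAt.const_smul
  unfold circleIntegral
  let _ : MeasurableSpace E := borel E
  have : BorelSpace E := ⟨rfl⟩
  let _ : MeasurableSpace (E →L[ℂ] G) := borel _
  have : BorelSpace (E →L[ℂ] G) := ⟨rfl⟩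
  have : ProperSpace (E →L[ℂ] G) := FiniteDimensional.proper ℂ _
  have hcm : ∀ t : ℝ, circleMap 0 ρ t ∈ closedBall (0:ℂ) ρ := fun t =>
    circleMap_mem_closedBall 0 hρ0.le t
  have hcont : ∀ w ∈ ball w₀ (R/4), Continuous (fun t : ℝ => deriv (circleMap 0 ρ) t •
      (1 / (circleMap 0 ρ t - 0) ^ 2) • f (w + circleMap 0 ρ t • v)) := by
    intro w hw
    have hcc : Continuous (circleMap (0:ℂ) ρ) := continuous_circleMap 0 ρ
    have h1 : Continuous fun t : ℝ => f (w + circleMap 0 ρ t • v) := by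
      rw [continuous_iff_continuousAt]
      intro t
      exact (hdat _ (hin w hw _ (hcm t))).continuousAt.comp
        (f := fun t : ℝ => w + circleMap 0 ρ t • v) (by fun_prop)
    have h2 : Continuous fun t : ℝ => 1 / (circleMap (0:ℂ) ρ t - 0) ^ 2 := by
      refine Continuous.div continuous_const (by fun_prop) ?_
      intro t
      simpa using hρ0.ne'
    have h3 : Continuous fun t : ℝ => deriv (circleMap (0:ℂ) ρ) t := by
      simp only [deriv_circleMap]; fun_prop
    exact h3.smul (h2.smul h1)
  have hnorm : ∀ t : ℝ, ‖deriv (circleMap (0:ℂ) ρ) t * (1 / (circleMap 0 ρ t - 0) ^ 2)‖ ≤ 1/ρ := by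
    intro t
    simp [abs_of_pos hρ0]
    field_simp
    rfl
  refine (intervalIntegral.hasFDerivAt_integral_of_dominated_of_fderiv_le (𝕜 := ℂ)
    (s := ball w₀ (R/4))
    (F' := fun w t => deriv (circleMap 0 ρ) t •
      (1 / (circleMap 0 ρ t - 0) ^ 2) • fderiv ℂ f (w + circleMap 0 ρ t • v))
    (bound := fun _ => 1/ρ * (2 / (R/2))) hnhds ?_ ?_ ?_ ?_ ?_ ?_).differentiableAt
  · filter_upwards [hnhds] with w hw using (hcont w hw).aestronglyMeasurable
  · exact (hcont w₀ (mem_ball_self (by positivity))).intervalIntegrable _ _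
  · have hcc : Continuous (circleMap (0:ℂ) ρ) := continuous_circleMap 0 ρ
    have hm : Measurable fun t : ℝ => fderiv ℂ f (w₀ + circleMap 0 ρ t • v) :=
      (measurable_fderiv ℂ f).comp
        (Continuous.measurable (f := fun t : ℝ => w₀ + circleMap 0 ρ t • v) (by fun_prop))
    have h2 : Continuous fun t : ℝ => 1 / (circleMap (0:ℂ) ρ t - 0) ^ 2 := by
      refine Continuous.div continuous_const (by fun_prop) ?_
      intro t
      simpa using hρ0.ne'
    have h3 : Continuous fun t : ℝ => deriv (circleMap (0:ℂ) ρ) t := by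
      simp only [deriv_circleMap]; fun_prop
    exact (h3.aestronglyMeasurable.smul (h2.aestronglyMeasurable.smul hm.aestronglyMeasurable))
  · refine Eventually.of_forall fun t _ w hw => ?_
    rw [smul_smul, norm_smul]
    exact mul_le_mul (hnorm t) (hol_fderiv_bound hR hfR hb (hin w hw _ (hcm t))) (norm_nonneg _)
      (by positivity)
  · exact intervalIntegrable_const
  · refine Eventually.of_forall fun t _ w hw => ?_
    refine HasFDerivAt.const_smul (HasFDerivAt.const_smul ?_ _) _
    exact (hasFDerivAt_comp_add_right _).2 (hdat _ (hin w hw _ (hcm t))).hasFDerivAt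

theorem hol_fderiv {f : E → G} {U : Set E} (hU : IsOpen U) (hf : DifferentiableOn ℂ f U) :
    DifferentiableOn ℂ (fderiv ℂ f) U := by
  have hd : Module.finrank ℂ E = Module.finrank ℂ (Fin (Module.finrank ℂ E) → ℂ) := by simp
  let e₁ := ContinuousLinearEquiv.ofFinrankEq hd
  let e₂ := (e₁.arrowCongr (1 : G ≃L[ℂ] G)).trans (ContinuousLinearEquiv.piRing (Fin (Module.finrank ℂ E)))
  rw [← e₂.comp_differentiableOn_iff, differentiableOn_pi]
  intro i
  exact hol_pd hU hf _

theorem pd_comm {f : E → G} {U : Set E} (hU : IsOpen U) (hf : DifferentiableOn ℂ f U)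
    {w : E} (hw : w ∈ U) (a b : E) :
    fderiv ℂ (fun w => fderiv ℂ f w b) w a = fderiv ℂ (fun w => fderiv ℂ f w a) w b := by
  have h1 := (hol_fderiv hU hf).differentiableAt (hU.mem_nhds hw)
  have h2 : ∀ c, fderiv ℂ (fun w => fderiv ℂ f w c) w = (fderiv ℂ (fderiv ℂ f) w).flip c := by
    intro c
    exact ((ContinuousLinearMap.apply ℂ G c).hasFDerivAt.comp w h1.hasFDerivAt).fderiv
  rw [h2, h2]
  refine second_derivative_symmetric_of_eventually (f := f) ?_ h1.hasFDerivAt a b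
  filter_upwards [hU.mem_nhds hw] with y hy
  exact (hf.differentiableAt (hU.mem_nhds hy)).hasFDerivAt

/-- directional derivative -/
def pd (v : E) (f : E → G) : E → G := fun w => fderiv ℂ f w v

/-- iterated directional derivative -/
def pdl : List E → (E → G) → (E → G)
  | [], f => f
  | v :: l, f => pdl l (pd v f)

theorem pd_hol {f : E → G} {U : Set E} (hU : IsOpen U) (hf : DifferentiableOn ℂ f U) (v : E) :
    DifferentiableOn ℂ (pd v f) U := hol_pd hU hf v

theorem pdl_hol {U : Set E} (hU : IsOpen U) (l : List E) : ∀ {f : E → G},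
    DifferentiableOn ℂ f U → DifferentiableOn ℂ (pdl l f) U := by
  induction l with
  | nil => intro f hf; exact hf
  | cons v l ih => intro f hf; exact ih (pd_hol hU hf v)

theorem pd_congr {U : Set E} (hU : IsOpen U) {f g : E → G} (h : EqOn f g U) (v : E) :
    EqOn (pd v f) (pd v g) U := by
  intro w hw
  unfold pd
  rw [(h.eventuallyEq_of_mem (hU.mem_nhds hw)).fderiv_eq]

theorem pdl_congr {U : Set E} (hU : IsOpen U) (l : List E) : ∀ {f g : E → G},
    EqOn f g U → EqOn (pdl l f) (pdl l g) U := by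
  induction l with
  | nil => intro f g h; exact h
  | cons v l ih => intro f g h; exact ih (pd_congr hU h v)

theorem pd_add {U : Set E} (hU : IsOpen U) {f g : E → G} (hf : DifferentiableOn ℂ f U)
    (hg : DifferentiableOn ℂ g U) (v : E) :
    EqOn (pd v (fun w => f w + g w)) (fun w => pd v f w + pd v g w) U := by
  intro w hw
  unfold pd
  simp only [fderiv_fun_add (hf.differentiableAt (hU.mem_nhds hw))
    (hg.differentiableAt (hU.mem_nhds hw)), _root_.add_apply]

theorem pdl_add {U : Set E} (hU : IsOpen U) (l : List E) : ∀ {f g : E → G},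
    DifferentiableOn ℂ f U → DifferentiableOn ℂ g U →
    EqOn (pdl l (fun w => f w + g w)) (fun w => pdl l f w + pdl l g w) U := by
  induction l with
  | nil => intro f g _ _ w _; rfl
  | cons v l ih =>
    intro f g hf hg w hw
    exact (pdl_congr hU l (pd_add hU hf hg v) hw).trans (ih (pd_hol hU hf v) (pd_hol hU hg v) hw)

theorem pd_clm {G' : Type*} [NormedAddCommGroup G'] [NormedSpace ℂ G'] [FiniteDimensional ℂ G']
    {U : Set E} (hU : IsOpen U) {f : E → G} (hf : DifferentiableOn ℂ f U) (L : G →L[ℂ] G') (v : E) :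
    EqOn (pd v (fun w => L (f w))) (fun w => L (pd v f w)) U := by
  intro w hw
  unfold pd
  have h := (L.hasFDerivAt.comp w (hf.differentiableAt (hU.mem_nhds hw)).hasFDerivAt).fderiv
  have h' : fderiv ℂ (fun w => L (f w)) w = L.comp (fderiv ℂ f w) := h
  rw [h']; rfl

theorem pdl_clm {G' : Type*} [NormedAddCommGroup G'] [NormedSpace ℂ G'] [FiniteDimensional ℂ G']
    {U : Set E} (hU : IsOpen U) (L : G →L[ℂ] G') (l : List E) : ∀ {f : E → G},
    DifferentiableOn ℂ f U →
    EqOn (pdl l (fun w => L (f w))) (fun w => L (pdl l f w)) U := by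
  induction l with
  | nil => intro f _ w _; rfl
  | cons v l ih =>
    intro f hf w hw
    exact (pdl_congr hU l (pd_clm hU hf L v) hw).trans (ih (pd_hol hU hf v) hw)

theorem pd_mul {U : Set E} (hU : IsOpen U) {f g : E → ℂ} (hf : DifferentiableOn ℂ f U)
    (hg : DifferentiableOn ℂ g U) (v : E) :
    EqOn (pd v (fun w => g w * f w)) (fun w => g w * pd v f w + pd v g w * f w) U := by
  intro w hw
  unfold pd
  rw [fderiv_fun_mul (hg.differentiableAt (hU.mem_nhds hw))
    (hf.differentiableAt (hU.mem_nhds hw))]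
  simp [mul_comm]

/-- vanishing to order `k` at `p` -/
def VO (p : E) (k : ℕ) (f : E → G) : Prop := ∀ l : List E, l.length < k → pdl l f p = 0

theorem VO.mono {p : E} {k k' : ℕ} {f : E → G} (h : VO p k f) (hk : k' ≤ k) : VO p k' f :=
  fun l hl => h l (hl.trans_le hk)

theorem VO.pd {p : E} {k : ℕ} {f : E → G} (h : VO p (k+1) f) (v : E) : VO p k (pd v f) :=
  fun l hl => h (v :: l) (by simpa using hl)

theorem VO.congr {p : E} {U : Set E} (hU : IsOpen U) (hp : p ∈ U) {k : ℕ} {f g : E → G}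
    (h : VO p k f) (hfg : EqOn f g U) : VO p k g :=
  fun l hl => by rw [← pdl_congr hU l hfg hp]; exact h l hl

theorem VO.add {p : E} {U : Set E} (hU : IsOpen U) (hp : p ∈ U) {k : ℕ} {f g : E → G}
    (hf : DifferentiableOn ℂ f U) (hg : DifferentiableOn ℂ g U)
    (h : VO p k f) (h' : VO p k g) : VO p k (fun w => f w + g w) :=
  fun l hl => by rw [pdl_add hU l hf hg hp]; simp [h l hl, h' l hl]

theorem VO.clm {G' : Type*} [NormedAddCommGroup G'] [NormedSpace ℂ G'] [FiniteDimensional ℂ G']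
    {p : E} {U : Set E} (hU : IsOpen U) (hp : p ∈ U) {k : ℕ} {f : E → G}
    (hf : DifferentiableOn ℂ f U) (h : VO p k f) (L : G →L[ℂ] G') :
    VO p k (fun w => L (f w)) :=
  fun l hl => by rw [pdl_clm hU L l hf hp]; simp [h l hl]

theorem VO.mul {p : E} {U : Set E} (hU : IsOpen U) (hp : p ∈ U) : ∀ {k : ℕ} {g f : E → ℂ},
    DifferentiableOn ℂ g U → DifferentiableOn ℂ f U →
    VO p k f → VO p k (fun w => g w * f w) := by
  intro k
  induction k with
  | zero => intro g f _ _ _ l hl; simp at hl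
  | succ k ih =>
    intro g f hg hf h l hl
    cases l with
    | nil =>
      have : f p = 0 := h [] (by simp)
      simp [pdl, this]
    | cons v l =>
      have h1 : VO p k (_root_.pd v (fun w => g w * f w)) := by
        refine VO.congr hU hp ?_ (pd_mul hU hf hg v).symm
        refine VO.add hU hp ?_ ?_ (ih hg (pd_hol hU hf v) (h.pd v))
          (ih (pd_hol hU hg v) hf (h.mono (Nat.le_succ k)))
        · exact hg.mul (pd_hol hU hf v)
        · exact (pd_hol hU hg v).mul hf
      exact h1 l (by simpa using hl)

theorem pdl_zero (l : List E) : pdl l (fun _ : E => (0 : G)) = fun _ => 0 := by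
  induction l with
  | nil => rfl
  | cons v l ih =>
    have : pd v (fun _ : E => (0 : G)) = fun _ => 0 := by
      funext w; simp [pd]
    simp [pdl, this, ih]

theorem VO.zero (p : E) (k : ℕ) : VO p k (fun _ : E => (0 : G)) := by
  intro l _; rw [pdl_zero]

theorem VO.sum {ι : Type*} {p : E} {U : Set E} (hU : IsOpen U) (hp : p ∈ U) {k : ℕ}
    (s : Finset ι) {f : ι → E → G} (hf : ∀ i ∈ s, DifferentiableOn ℂ (f i) U)
    (h : ∀ i ∈ s, VO p k (f i)) : VO p k (fun w => ∑ i ∈ s, f i w) := by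
  classical
  induction s using Finset.induction_on with
  | empty => simpa using VO.zero p k
  | insert i s hi ih =>
    simp only [Finset.sum_insert hi]
    refine VO.add hU hp (hf i (by simp)) ?_ (h i (by simp))
      (ih (fun j hj => hf j (by simp [hj])) (fun j hj => h j (by simp [hj])))
    exact DifferentiableOn.fun_sum fun j hj => hf j (by simp [hj])

theorem VO.neg {p : E} {U : Set E} (hU : IsOpen U) (hp : p ∈ U) {k : ℕ} {f : E → G}
    (hf : DifferentiableOn ℂ f U) (h : VO p k f) : VO p k (fun w => - f w) :=
  VO.clm hU hp hf h (-(ContinuousLinearMap.id ℂ G))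

theorem VO.sub {p : E} {U : Set E} (hU : IsOpen U) (hp : p ∈ U) {k : ℕ} {f g : E → G}
    (hf : DifferentiableOn ℂ f U) (hg : DifferentiableOn ℂ g U)
    (h : VO p k f) (h' : VO p k g) : VO p k (fun w => f w - g w) := by
  simp only [sub_eq_add_neg]
  exact VO.add hU hp hf hg.neg h (VO.neg hU hp hg h')

theorem eq_zero_ball {f : E → G} {p : E} {r : ℝ} (hf : DifferentiableOn ℂ f (ball p r))
    (h : ∀ l, pdl l f p = 0) : ∀ w ∈ ball p r, f w = 0 := by
  intro w hw
  have : CompleteSpace G := FiniteDimensional.complete ℂ G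
  by_cases hwp : w = p
  · rw [hwp]; exact h []
  set v := w - p with hv
  have hv0 : 0 < ‖v‖ := by rw [norm_pos_iff, hv, sub_ne_zero]; exact hwp
  have hvr : ‖v‖ < r := by rw [mem_ball, dist_eq_norm] at hw; exact hw
  have hr : 0 < r := hv0.trans hvr
  have hin : ∀ t ∈ ball (0:ℂ) (r/‖v‖), p + t • v ∈ ball p r := by
    intro t ht
    rw [mem_ball, dist_zero_right, lt_div_iff₀ hv0] at ht
    rw [mem_ball, dist_eq_norm, add_sub_cancel_left, norm_smul]; exact ht
  have hder : ∀ g : E → G, DifferentiableOn ℂ g (ball p r) → ∀ t ∈ ball (0:ℂ) (r/‖v‖),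
      HasDerivAt (fun t : ℂ => g (p + t • v)) (pd v g (p + t • v)) t := by
    intro g hg t ht
    have h1 := (hg.differentiableAt (isOpen_ball.mem_nhds (hin t ht))).hasFDerivAt
    have h2 : HasDerivAt (fun z : ℂ => p + z • v) v t := by
      simpa using ((hasDerivAt_id t).smul_const v).const_add p
    exact h1.comp_hasDerivAt t h2
  have hpos : 0 < r / ‖v‖ := by positivity
  have hit : ∀ k : ℕ, ∀ g : E → G, DifferentiableOn ℂ g (ball p r) →
      iteratedDeriv k (fun t : ℂ => g (p + t • v)) 0 = pdl (List.replicate k v) g p := by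
    intro k
    induction k with
    | zero => intro g hg; simp [pdl]
    | succ k ih =>
      intro g hg
      rw [iteratedDeriv_succ', List.replicate_succ]
      show _ = pdl (List.replicate k v) (pd v g) p
      rw [← ih _ (pd_hol isOpen_ball hg v)]
      apply Filter.EventuallyEq.iteratedDeriv_eq
      filter_upwards [isOpen_ball.mem_nhds (mem_ball_self hpos)] with t ht
      exact (hder g hg t ht).deriv
  have hT := Complex.hasSum_taylorSeries_on_ball (f := fun t : ℂ => f (p + t • v)) (c := 0)
    (r := r/‖v‖) (fun t ht => (hder f hf t ht).differentiableAt.differentiableWithinAt)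
    (z := 1) (by rw [mem_ball, dist_zero_right, norm_one, one_lt_div hv0]; exact hvr)
  simp only [hit _ f hf, h, smul_zero] at hT
  have := hT.unique hasSum_zero
  simpa [hv] using this

theorem eq_zero_of_VO {f : E → G} {p : E} {U : Set E} (hU : IsOpen U) (hUc : IsPreconnected U)
    (hp : p ∈ U) (hf : DifferentiableOn ℂ f U) (h : ∀ k, VO p k f) : ∀ w ∈ U, f w = 0 := by
  let A : Set E := {w | w ∈ U ∧ ∀ l, pdl l f w = 0}
  have hA : IsOpen A := by
    rw [Metric.isOpen_iff]
    rintro w ⟨hw, hl⟩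
    obtain ⟨r, hr, hrU⟩ := Metric.isOpen_iff.1 hU w hw
    refine ⟨r, hr, fun y hy => ⟨hrU hy, fun l => ?_⟩⟩
    have hz := eq_zero_ball (hf.mono hrU) hl
    have := pdl_congr isOpen_ball l (f := f) (g := fun _ => 0) (fun y hy => hz y hy) hy
    rw [this, pdl_zero]
  have hsub : U ⊆ A := by
    refine hUc.subset_of_closure_inter_subset hA ⟨p, hp, hp, fun l => h (l.length+1) l (by simp)⟩ ?_
    rintro w ⟨hwA, hw⟩
    refine ⟨hw, fun l => ?_⟩
    have hc := ((pdl_hol hU l hf).differentiableAt (hU.mem_nhds hw)).continuousAt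
    have h1 : Filter.Tendsto (pdl l f) (𝓝[A] w) (𝓝 (pdl l f w)) := hc.mono_left nhdsWithin_le_nhds
    have h2 : Filter.Tendsto (pdl l f) (𝓝[A] w) (𝓝 0) := by
      refine tendsto_const_nhds.congr' ?_
      filter_upwards [self_mem_nhdsWithin] with y hy using (hy.2 l).symm
    have : (𝓝[A] w).NeBot := mem_closure_iff_nhdsWithin_neBot.1 hwA
    exact tendsto_nhds_unique h1 h2
  intro w hw
  exact (hsub hw).2 []

end Hol

section Alg
variable {n m : ℕ}

/-- spanning vectors of the graph of `q` -/
def wv (q : Jsp n m) (i : Fin n) : Wsp n m := (Pi.single i 1, fun k => q k i)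

/-- continuous version of a bilinear map -/
def toCB (T : Wsp n m →ₗ[ℂ] Wsp n m →ₗ[ℂ] Wsp n m) : Wsp n m →L[ℂ] Wsp n m →L[ℂ] Wsp n m :=
  LinearMap.toContinuousLinearMap
    ((LinearMap.toContinuousLinearMap : (Wsp n m →ₗ[ℂ] Wsp n m) ≃ₗ[ℂ] _).toLinearMap ∘ₗ T)

theorem toCB_apply (T : Wsp n m →ₗ[ℂ] Wsp n m →ₗ[ℂ] Wsp n m) (a b : Wsp n m) :
    toCB T a b = T a b := rfl

theorem alg_allq (T : Wsp n m →ₗ[ℂ] Wsp n m →ₗ[ℂ] Wsp n m) (Q : Set (Jsp n m)) (hQ : IsOpen Q)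
    (hQn : Q.Nonempty)
    (h : ∀ q ∈ Q, ∀ i j μ, (T (wv q i) (wv q j)).2 μ - ∑ s, (T (wv q i) (wv q j)).1 s * q μ s = 0) :
    ∀ q : Jsp n m, ∀ i j μ,
      (T (wv q i) (wv q j)).2 μ - ∑ s, (T (wv q i) (wv q j)).1 s * q μ s = 0 := by
  intro q i j μ
  obtain ⟨q₀, hq₀⟩ := hQn
  let f : Jsp n m → ℂ := fun q =>
    (toCB T (wv q i) (wv q j)).2 μ - ∑ s, (toCB T (wv q i) (wv q j)).1 s * q μ s
  have hw : ∀ i, Differentiable ℂ (fun q : Jsp n m => wv q i) := by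
    intro i; unfold wv; fun_prop
  have hT : Differentiable ℂ (fun q : Jsp n m => toCB T (wv q i) (wv q j)) :=
    ((toCB T).differentiable.comp (hw i)).clm_apply (hw j)
  have hf : Differentiable ℂ f := by
    have h1 : ∀ s, Differentiable ℂ (fun q : Jsp n m => (toCB T (wv q i) (wv q j)).1 s) := by
      intro s; exact differentiable_pi.1 hT.fst s
    have h2 : Differentiable ℂ (fun q : Jsp n m => (toCB T (wv q i) (wv q j)).2 μ) :=
      differentiable_pi.1 hT.snd μ
    refine h2.sub (Differentiable.fun_sum fun s _ => (h1 s).mul ?_)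
    fun_prop
  refine eq_zero_of_VO (f := f) (p := q₀) isOpen_univ isPreconnected_univ (mem_univ _)
    hf.differentiableOn ?_ q (mem_univ _)
  intro k l _
  have h0 : EqOn f (fun _ => 0) Q := fun q hq => h q hq i j μ
  rw [pdl_congr hQ l h0 hq₀, pdl_zero]

theorem alg_graph (T : Wsp n m →ₗ[ℂ] Wsp n m →ₗ[ℂ] Wsp n m)
    (h : ∀ q : Jsp n m, ∀ i j μ,
      (T (wv q i) (wv q j)).2 μ - ∑ s, (T (wv q i) (wv q j)).1 s * q μ s = 0)
    (q : Jsp n m) (x y : Fin n → ℂ) (μ : Fin m) :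
    (T (x, fun k => ∑ i, q k i * x i) (y, fun k => ∑ i, q k i * y i)).2 μ =
      ∑ s, (T (x, fun k => ∑ i, q k i * x i) (y, fun k => ∑ i, q k i * y i)).1 s * q μ s := by
  have hx : ∀ x : Fin n → ℂ, ((x, fun k => ∑ i, q k i * x i) : Wsp n m) = ∑ i, x i • wv q i := by
    intro x
    ext k
    · simp [wv, Prod.fst_sum, Finset.sum_apply, Pi.single_apply]
    · simp [wv, Prod.snd_sum, Finset.sum_apply, mul_comm]
  rw [← sub_eq_zero, hx x, hx y]
  obtain ⟨Λ, hΛ⟩ : ∃ Λ : Wsp n m →ₗ[ℂ] ℂ, ∀ z : Wsp n m, z.2 μ - ∑ s, z.1 s * q μ s = Λ z :=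
    ⟨LinearMap.proj μ ∘ₗ LinearMap.snd ℂ (Fin n → ℂ) (Fin m → ℂ) -
        ∑ s, q μ s • (LinearMap.proj s ∘ₗ LinearMap.fst ℂ (Fin n → ℂ) (Fin m → ℂ)), by
      intro z
      simp [LinearMap.sum_apply, mul_comm]⟩
  have h2 : ∀ i j, Λ (T (wv q i) (wv q j)) = 0 := by
    intro i j; rw [← hΛ]; exact h q i j μ
  rw [hΛ]
  simp only [map_sum, map_smul, LinearMap.sum_apply, LinearMap.smul_apply, h2, smul_zero,
    Finset.sum_const_zero]

theorem alg_par_x (T : Wsp (n+1) (m+1) →ₗ[ℂ] Wsp (n+1) (m+1) →ₗ[ℂ] Wsp (n+1) (m+1))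
    (h : ∀ q : Jsp (n+1) (m+1), ∀ i j μ,
      (T (wv q i) (wv q j)).2 μ - ∑ s, (T (wv q i) (wv q j)).1 s * q μ s = 0)
    (a : Wsp (n+1) (m+1)) (ha : a.1 ≠ 0) : ∃ c : ℂ, T a a = c • a := by
  obtain ⟨i₀, hi₀⟩ := Function.ne_iff.1 ha
  simp only [Pi.zero_apply] at hi₀
  have key : ∀ q : Jsp (n+1) (m+1), (∀ k, ∑ i, q k i * a.1 i = a.2 k) →
      ∀ μ, (T a a).2 μ = ∑ s, (T a a).1 s * q μ s := by
    intro q hq μ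
    have := alg_graph T h q a.1 a.1 μ
    have ha : ((a.1, fun k => ∑ i, q k i * a.1 i) : Wsp (n+1) (m+1)) = a := by
      ext k
      · rfl
      · exact hq k
    rwa [ha] at this
  let q₀ : Jsp (n+1) (m+1) := fun k i => if i = i₀ then a.2 k / a.1 i₀ else 0
  have h0 : ∀ k, ∑ i, q₀ k i * a.1 i = a.2 k := by
    intro k; simp [q₀, hi₀]
  have hz2 : ∀ μ, (T a a).2 μ = (T a a).1 i₀ * (a.2 μ / a.1 i₀) := by
    intro μ; rw [key q₀ h0 μ]; simp [q₀]
  have hz1 : ∀ s, (T a a).1 s * a.1 i₀ = (T a a).1 i₀ * a.1 s := by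
    intro s
    let r : Jsp (n+1) (m+1) := fun k i => q₀ k i +
      ((if i = s then a.1 i₀ else 0) - (if i = i₀ then a.1 s else 0))
    have h1 : ∀ k, ∑ i, r k i * a.1 i = a.2 k := by
      intro k
      simp only [r, add_mul, sub_mul, Finset.sum_add_distrib, Finset.sum_sub_distrib, h0]
      simp [mul_comm]
    have e1 := key r h1 0
    rw [key q₀ h0 0] at e1
    simp only [r, mul_add, mul_sub, Finset.sum_add_distrib, Finset.sum_sub_distrib] at e1
    simp at e1
    linear_combination e1
  refine ⟨(T a a).1 i₀ / a.1 i₀, ?_⟩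
  ext k
  · have := hz1 k
    simp only [Prod.smul_fst, Pi.smul_apply, smul_eq_mul]
    field_simp
    exact this
  · simp only [Prod.smul_snd, Pi.smul_apply, smul_eq_mul, hz2]
    field_simp

theorem alg_par (T : Wsp (n+1) (m+1) →ₗ[ℂ] Wsp (n+1) (m+1) →ₗ[ℂ] Wsp (n+1) (m+1))
    (Q : Set (Jsp (n+1) (m+1))) (hQ : IsOpen Q) (hQn : Q.Nonempty)
    (h : ∀ q ∈ Q, ∀ i j μ, (T (wv q i) (wv q j)).2 μ - ∑ s, (T (wv q i) (wv q j)).1 s * q μ s = 0)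
    (a : Wsp (n+1) (m+1)) : ∃ c : ℂ, T a a = c • a := by
  have h' := alg_allq T Q hQ hQn h
  by_cases ha : a.1 = 0
  swap
  · exact alg_par_x T h' a ha
  by_cases hu : a.2 = 0
  · have : a = 0 := Prod.ext ha hu
    exact ⟨0, by simp [this]⟩
  obtain ⟨k₀, hk₀⟩ := Function.ne_iff.1 hu
  simp only [Pi.zero_apply] at hk₀
  let avec : ℂ → Wsp (n+1) (m+1) := fun t => (t • Pi.single 0 1, a.2)
  have hat : Continuous avec := by fun_prop
  have hat0 : avec 0 = a := by
    ext k
    · simp [avec, ha]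
    · rfl
  have hpar : ∀ t, t ≠ 0 → ∃ c : ℂ, T (avec t) (avec t) = c • avec t := by
    intro t ht
    apply alg_par_x T h'
    intro h0
    have := congrFun h0 0
    simp [avec, ht] at this
  have hTc : Continuous (fun t => T (avec t) (avec t)) := by
    have : Continuous (fun t => toCB T (avec t) (avec t)) :=
      ((toCB T).continuous.comp hat).clm_apply hat
    exact this
  have hd : Dense ({0}ᶜ : Set ℂ) := dense_compl_singleton 0
  have e1 : ∀ s, (T a a).1 s * a.2 k₀ = (T a a).2 k₀ * a.1 s := by
    intro s
    have hc : (fun t => (T (avec t) (avec t)).1 s * (avec t).2 k₀) =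
        fun t => (T (avec t) (avec t)).2 k₀ * (avec t).1 s := by
      refine Continuous.ext_on hd ?_ ?_ ?_
      · exact ((continuous_apply s).comp (continuous_fst.comp hTc)).mul
          ((continuous_apply k₀).comp (continuous_snd.comp hat))
      · exact ((continuous_apply k₀).comp (continuous_snd.comp hTc)).mul
          ((continuous_apply s).comp (continuous_fst.comp hat))
      · intro t ht
        obtain ⟨c, hc⟩ := hpar t ht
        simp only [hc, Prod.smul_fst, Prod.smul_snd, Pi.smul_apply, smul_eq_mul]; ring
    have := congrFun hc 0
    simpa only [hat0] using this
  have e2 : ∀ k, (T a a).2 k * a.2 k₀ = (T a a).2 k₀ * a.2 k := by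
    intro k
    have hc : (fun t => (T (avec t) (avec t)).2 k * (avec t).2 k₀) =
        fun t => (T (avec t) (avec t)).2 k₀ * (avec t).2 k := by
      refine Continuous.ext_on hd ?_ ?_ ?_
      · exact ((continuous_apply k).comp (continuous_snd.comp hTc)).mul
          ((continuous_apply k₀).comp (continuous_snd.comp hat))
      · exact ((continuous_apply k₀).comp (continuous_snd.comp hTc)).mul
          ((continuous_apply k).comp (continuous_snd.comp hat))
      · intro t ht
        obtain ⟨c, hc⟩ := hpar t ht
        simp only [hc, Prod.smul_snd, Pi.smul_apply, smul_eq_mul]; ring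
    have := congrFun hc 0
    simpa only [hat0] using this
  refine ⟨(T a a).2 k₀ / a.2 k₀, ?_⟩
  ext k
  · have := e1 k
    simp only [Prod.smul_fst, Pi.smul_apply, smul_eq_mul]
    field_simp
    exact this
  · have := e2 k
    simp only [Prod.smul_snd, Pi.smul_apply, smul_eq_mul]
    field_simp
    exact this

variable {E : Type*} [AddCommGroup E] [Module ℂ E]

theorem alg_mixed (T : E →ₗ[ℂ] E →ₗ[ℂ] E) (hs : ∀ a b, T a b = T b a)
    (L : E → ℂ) (hL : ∀ a, T a a = (2 * L a) • a) (a b : E)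
    (hab : LinearIndependent ℂ ![a, b]) : T a b = L b • a + L a • b := by
  rw [LinearIndependent.pair_iff] at hab
  have e1 := hL (a + b)
  have e2 := hL (a - b)
  simp only [map_add, map_sub, LinearMap.add_apply, LinearMap.sub_apply, hL a, hL b, hs b a]
    at e1 e2
  obtain ⟨h1, h2⟩ := hab (4 * L a - 2 * L (a+b) - 2 * L (a-b))
    (4 * L b - 2 * L (a+b) + 2 * L (a-b)) (by
      linear_combination (norm := module) e1 + e2)
  have h3 : L (a + b) = L a + L b := by linear_combination -(h1 + h2) / 4
  have h4 : L (a - b) = L a - L b := by linear_combination -(h1 - h2) / 4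
  rw [h3] at e1
  have : (2:ℂ) • T a b = (2:ℂ) • (L b • a + L a • b) := by
    linear_combination (norm := module) e1
  exact smul_right_injective _ (two_ne_zero) this

theorem alg_polar (T : E →ₗ[ℂ] E →ₗ[ℂ] E) (hs : ∀ a b, T a b = T b a)
    (h : ∀ a, T a a = 0) (a b : E) : T a b = 0 := by
  have e := h (a + b)
  simp only [map_add, LinearMap.add_apply, h, hs b a, zero_add, add_zero] at e
  have : (2:ℂ) • T a b = 0 := by rw [two_smul]; exact e
  exact (smul_eq_zero.1 this).resolve_left two_ne_zero

theorem indep_or {a b : E} (ha : a ≠ 0) : LinearIndependent ℂ ![a, b] ∨ ∃ c : ℂ, b = c • a := by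
  by_cases h : ∃ c : ℂ, b = c • a
  · exact Or.inr h
  · left
    rw [LinearIndependent.pair_iff' ha]
    intro c hc
    exact h ⟨c, hc.symm⟩

theorem alg_third (hdim : ∀ a : E, a ≠ 0 → ∃ b, LinearIndependent ℂ ![a, b])
    (T : E → (E →ₗ[ℂ] E →ₗ[ℂ] E)) (hs : ∀ v a b, T v a b = T v b a)
    (hs' : ∀ v a b, T v a b = T a v b)
    (h : ∀ v a, ∃ c : ℂ, T v a a = c • a) (v a b : E) : T v a b = 0 := by
  choose L' hL' using h
  have hL : ∀ v a, T v a a = (2 * (L' v a / 2)) • a := by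
    intro v a; rw [hL']; congr 1; ring
  have key : ∀ a b, LinearIndependent ℂ ![a, b] → L' a a = 0 ∧ 2 * L' b a = L' a b := by
    intro a b hab
    have e := alg_mixed (T a) (hs a) (fun b => L' a b / 2) (hL a) a b hab
    rw [hs a, hs' a b a, hL'] at e
    rw [LinearIndependent.pair_iff] at hab
    obtain ⟨h1, h2⟩ := hab (L' b a - L' a b / 2) (- (L' a a / 2)) (by
      linear_combination (norm := module) e)
    constructor
    · linear_combination -2 * h2
    · linear_combination 2 * h1
  apply alg_polar (T v) (hs v)
  intro a
  by_cases ha : a = 0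
  · simp [ha]
  rcases indep_or (b := v) ha with hi | ⟨c, hc⟩
  · have h1 := (key a v hi).2
    have h2 := (key v a ((LinearIndependent.pair_symm_iff).1 hi)).2
    have h3 : L' v a = 0 := by linear_combination (2 * h1 + h2) / 3
    rw [hL', h3, zero_smul]
  · obtain ⟨b, hb⟩ := hdim a ha
    rw [hs', hc]
    simp [hL' a a, (key a b hb).1]

theorem alg_second (T : E →ₗ[ℂ] E →ₗ[ℂ] E) (hs : ∀ a b, T a b = T b a)
    (h : ∀ a, ∃ c : ℂ, T a a = c • a) (e : E) (ε : E →ₗ[ℂ] ℂ) (he : ε e = 1)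
    (h0 : ∀ b, ε (T e b) = 0) (a b : E) : T a b = 0 := by
  choose L' hL' using h
  have hL : ∀ a, T a a = (2 * (L' a / 2)) • a := by
    intro a; rw [hL']; congr 1; ring
  have he0 : e ≠ 0 := by rintro rfl; simp at he
  have hLe : L' e = 0 := by
    have := h0 e
    rw [hL'] at this
    simpa [he] using this
  apply alg_polar T hs
  intro b
  rcases indep_or (b := b) he0 with hi | ⟨c, hc⟩
  · have e1 := alg_mixed T hs (fun a => L' a / 2) hL e b hi
    have e2 := h0 b
    rw [e1] at e2
    simp [hLe, he] at e2
    rw [hL', e2, zero_smul]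
  · simp [hc, hL' e, hLe]

theorem wsp_dim (a : Wsp (n+1) (m+1)) (ha : a ≠ 0) : ∃ b, LinearIndependent ℂ ![a, b] := by
  by_cases h1 : a.1 = 0
  · refine ⟨(Pi.single 0 1, 0), ?_⟩
    rw [LinearIndependent.pair_iff' ha]
    intro c hc
    have := congrFun (congrArg Prod.fst hc) 0
    simp [h1] at this
  · refine ⟨(0, Pi.single 0 1), ?_⟩
    rw [LinearIndependent.pair_iff' ha]
    intro c hc
    have e1 := congrArg Prod.fst hc
    simp [h1] at e1
    have := congrFun (congrArg Prod.snd hc) 0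
    simp [e1] at this
end Alg

section Main
variable {n m : ℕ}

theorem wv_eq (q : Jsp n m) (i : Fin n) : wv q i =
    ((Pi.single i 1 : Fin n → ℂ), (0 : Fin m → ℂ)) +
      ∑ k, q k i • ((0 : Fin n → ℂ), (Pi.single k 1 : Fin m → ℂ)) := by
  ext k
  · simp [wv, Prod.fst_sum, Finset.sum_apply]
  · simp [wv, Prod.snd_sum, Finset.sum_apply, Pi.single_apply]

theorem Dtot_eq (ψ : Wsp n m → ℂ) (i : Fin n) (w : Wsp n m) (q : Jsp n m) :
    Dtot ψ i (w, q) = pd (wv q i) ψ w := by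
  unfold Dtot pd
  rw [wv_eq]
  simp only [map_add, map_sum, map_smul, smul_eq_mul]

theorem eta1_eq (θ : Fin n → Wsp n m → ℂ) (η : Fin m → Wsp n m → ℂ) (μ : Fin m) (i : Fin n)
    (w : Wsp n m) (q : Jsp n m) :
    eta1 θ η μ i (w, q) = pd (wv q i) (η μ) w - ∑ j, pd (wv q i) (θ j) w * q μ j := by
  simp only [eta1, Dtot_eq]

theorem fderiv_left {E₁ E₂ : Type*} [NormedAddCommGroup E₁] [NormedSpace ℂ E₁]
    [NormedAddCommGroup E₂] [NormedSpace ℂ E₂] {f : E₁ × E₂ → ℂ} {w : E₁} {q : E₂}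
    (h : DifferentiableAt ℂ f (w, q)) (a : E₁) :
    fderiv ℂ f (w, q) (a, 0) = fderiv ℂ (fun w => f (w, q)) w a := by
  have h1 := HasFDerivAt.comp w (g := f) (f := fun w => (w, q)) h.hasFDerivAt
    (hasFDerivAt_prodMk_left (𝕜 := ℂ) w q)
  have h2 : fderiv ℂ (fun w => f (w, q)) w = _ := h1.fderiv
  rw [h2]; simp

theorem wv_add (q r : Jsp n m) (t : ℂ) (i : Fin n) :
    wv (q + t • r) i = wv q i + t • ((0, fun k => r k i) : Wsp n m) := by
  ext k <;> simp [wv]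

theorem eta1_diff {U : Set (Wsp n m)} (hU : IsOpen U)
    {θ : Fin n → Wsp n m → ℂ} {η : Fin m → Wsp n m → ℂ}
    (hθ : ∀ j, DifferentiableOn ℂ (θ j) U) (hη : ∀ μ, DifferentiableOn ℂ (η μ) U)
    (μ : Fin m) (i : Fin n) {w : Wsp n m} (hw : w ∈ U) (q : Jsp n m) :
    DifferentiableAt ℂ (eta1 θ η μ i) (w, q) := by
  have hwv : Differentiable ℂ (fun p : Psp n m => wv p.2 i) := by
    unfold wv; fun_prop
  have hD : ∀ ψ : Wsp n m → ℂ, DifferentiableOn ℂ ψ U →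
      DifferentiableAt ℂ (fun p : Psp n m => fderiv ℂ ψ p.1 (wv p.2 i)) (w, q) := by
    intro ψ hψ
    have h1 : DifferentiableAt ℂ (fderiv ℂ ψ) w :=
      (hol_fderiv hU hψ).differentiableAt (hU.mem_nhds hw)
    have h2 : DifferentiableAt ℂ (fun p : Psp n m => fderiv ℂ ψ p.1) (w, q) :=
      DifferentiableAt.comp (w, q) (f := fun p : Psp n m => p.1) h1 differentiableAt_fst
    exact h2.clm_apply hwv.differentiableAt
  have he : eta1 θ η μ i = fun p : Psp n m => fderiv ℂ (η μ) p.1 (wv p.2 i) -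
      ∑ j, fderiv ℂ (θ j) p.1 (wv p.2 i) * p.2 μ j := by
    funext p
    exact eta1_eq θ η μ i p.1 p.2
  rw [he]
  refine (hD _ (hη μ)).sub (DifferentiableAt.fun_sum fun j _ => (hD _ (hθ j)).mul ?_)
  fun_prop

theorem eta1_right {U : Set (Wsp n m)} (hU : IsOpen U)
    {θ : Fin n → Wsp n m → ℂ} {η : Fin m → Wsp n m → ℂ}
    (hθ : ∀ j, DifferentiableOn ℂ (θ j) U) (hη : ∀ μ, DifferentiableOn ℂ (η μ) U)
    (μ : Fin m) (i : Fin n) {w : Wsp n m} (hw : w ∈ U) (q r : Jsp n m) :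
    fderiv ℂ (eta1 θ η μ i) (w, q) (0, r) =
      pd ((0, fun k => r k i) : Wsp n m) (η μ) w -
        ∑ j, (pd ((0, fun k => r k i) : Wsp n m) (θ j) w * q μ j +
          pd (wv q i) (θ j) w * r μ j) := by
  have h1 := (eta1_diff hU hθ hη μ i hw q).hasFDerivAt
  have h2 : HasDerivAt (fun t : ℂ => ((w, q + t • r) : Psp n m)) (0, r) 0 := by
    refine (hasDerivAt_const (0:ℂ) w).prodMk ?_
    simpa using ((hasDerivAt_id (0:ℂ)).smul_const r).const_add q
  have h3 : HasDerivAt (fun t : ℂ => eta1 θ η μ i (w, q + t • r))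
      (fderiv ℂ (eta1 θ η μ i) (w, q) (0, r)) 0 := by
    have h1' : HasFDerivAt (eta1 θ η μ i) (fderiv ℂ (eta1 θ η μ i) (w, q))
        ((w, q + (0:ℂ) • r) : Psp n m) := by simpa using h1
    exact h1'.comp_hasDerivAt (0:ℂ) h2
  refine h3.unique ?_
  have h4 : (fun t : ℂ => eta1 θ η μ i (w, q + t • r)) = fun t : ℂ =>
      (pd (wv q i) (η μ) w + t * pd ((0, fun k => r k i) : Wsp n m) (η μ) w) -
      ∑ j, (pd (wv q i) (θ j) w + t * pd ((0, fun k => r k i) : Wsp n m) (θ j) w) *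
        (q μ j + t * r μ j) := by
    funext t
    rw [eta1_eq, wv_add]
    simp only [pd, map_add, map_smul, smul_eq_mul, Pi.add_apply, Pi.smul_apply]
  rw [h4]
  have hl : ∀ A B : ℂ, HasDerivAt (fun t : ℂ => A + t * B) B 0 := by
    intro A B
    simpa using ((hasDerivAt_id (0:ℂ)).mul_const B).const_add A
  refine (hl _ _).sub (HasDerivAt.fun_sum fun j _ => ?_)
  refine ((hl (pd (wv q i) (θ j) w) _).fun_mul (hl (q μ j) (r μ j))).congr_deriv ?_
  ring

theorem DtotF_eq {U : Set (Wsp n m)} (hU : IsOpen U)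
    (F : Fin n → Fin n → Fin m → Psp n m → ℂ)
    {θ : Fin n → Wsp n m → ℂ} {η : Fin m → Wsp n m → ℂ}
    (hθ : ∀ j, DifferentiableOn ℂ (θ j) U) (hη : ∀ μ, DifferentiableOn ℂ (η μ) U)
    (μ : Fin m) (i j : Fin n) {w : Wsp n m} (hw : w ∈ U) (q : Jsp n m) :
    DtotF F (eta1 θ η μ i) j (w, q) = pd (wv q j) (fun w => eta1 θ η μ i (w, q)) w +
      ∑ k, ∑ l, F j l k (w, q) * fderiv ℂ (eta1 θ η μ i) (w, q) (dirq n m k l) := by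
  unfold DtotF
  congr 1
  have h1 : pd (wv q j) (fun w => eta1 θ η μ i (w, q)) w =
      fderiv ℂ (eta1 θ η μ i) (w, q) (wv q j, 0) :=
    (fderiv_left (eta1_diff hU hθ hη μ i hw q) _).symm
  have h2 : ((wv q j, 0) : Psp n m) = dirx n m j + ∑ k, q k j • diru n m k := by
    rw [wv_eq]
    ext k <;> simp [dirx, diru, Prod.fst_sum, Prod.snd_sum]
  rw [h1, h2]
  simp [map_add, map_sum]

/-- The vector-valued function `(θ, η)`. -/
def Xf (θ : Fin n → Wsp n m → ℂ) (η : Fin m → Wsp n m → ℂ) : Wsp n m → Wsp n m :=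
  fun w => (fun j => θ j w, fun μ => η μ w)

theorem Xf_hol {U : Set (Wsp n m)} {θ : Fin n → Wsp n m → ℂ} {η : Fin m → Wsp n m → ℂ}
    (hθ : ∀ j, DifferentiableOn ℂ (θ j) U) (hη : ∀ μ, DifferentiableOn ℂ (η μ) U) :
    DifferentiableOn ℂ (Xf θ η) U :=
  (differentiableOn_pi.2 hθ).prodMk (differentiableOn_pi.2 hη)

/-- coordinate `x_j` -/
def cx (n m : ℕ) (j : Fin n) : Wsp n m →L[ℂ] ℂ :=
  (ContinuousLinearMap.proj j).comp (ContinuousLinearMap.fst ℂ (Fin n → ℂ) (Fin m → ℂ))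

/-- coordinate `u_k` -/
def cu (n m : ℕ) (k : Fin m) : Wsp n m →L[ℂ] ℂ :=
  (ContinuousLinearMap.proj k).comp (ContinuousLinearMap.snd ℂ (Fin n → ℂ) (Fin m → ℂ))

/-- the functional cutting out the graph of `q` -/
def Lam (q : Jsp n m) (μ : Fin m) : Wsp n m →L[ℂ] ℂ :=
  cu n m μ - ∑ s, q μ s • cx n m s

theorem Lam_apply (q : Jsp n m) (μ : Fin m) (z : Wsp n m) :
    Lam q μ z = z.2 μ - ∑ s, z.1 s * q μ s := by
  simp [Lam, cu, cx, mul_comm]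

/-- holomorphic and vanishing to order `k` -/
def HV (U : Set (Wsp n m)) (p : Wsp n m) (k : ℕ) (f : Wsp n m → ℂ) : Prop :=
  DifferentiableOn ℂ f U ∧ VO p k f

theorem leading {U : Set (Wsp n m)} {Q : Set (Jsp n m)} (hU : IsOpen U) (hQ : IsOpen Q)
    (F : Fin n → Fin n → Fin m → Psp n m → ℂ)
    (hF : ∀ i j k, DifferentiableOn ℂ (F i j k) (U ×ˢ Q))
    {θ : Fin n → Wsp n m → ℂ} {η : Fin m → Wsp n m → ℂ}
    (hθ : ∀ j, DifferentiableOn ℂ (θ j) U) (hη : ∀ μ, DifferentiableOn ℂ (η μ) U)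
    (hsym : IsSymmetry U Q F θ η) {p : Wsp n m} (hp : p ∈ U) {k : ℕ}
    (hV : VO p (k+2) (Xf θ η)) {q : Jsp n m} (hq : q ∈ Q) (i j : Fin n) (μ : Fin m)
    (l : List (Wsp n m)) (hl : l.length < k + 1) :
    Lam q μ (pdl l (pd (wv q j) (pd (wv q i) (Xf θ η))) p) = 0 := by
  have hX := Xf_hol hθ hη
  -- closure properties
  have hadd : ∀ {f g : Wsp n m → ℂ}, HV U p (k+1) f → HV U p (k+1) g →
      HV U p (k+1) (fun w => f w + g w) := fun hf hg =>
    ⟨hf.1.add hg.1, VO.add hU hp hf.1 hg.1 hf.2 hg.2⟩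
  have hsub : ∀ {f g : Wsp n m → ℂ}, HV U p (k+1) f → HV U p (k+1) g →
      HV U p (k+1) (fun w => f w - g w) := fun hf hg =>
    ⟨hf.1.sub hg.1, VO.sub hU hp hf.1 hg.1 hf.2 hg.2⟩
  have hmul : ∀ {g f : Wsp n m → ℂ}, DifferentiableOn ℂ g U → HV U p (k+1) f →
      HV U p (k+1) (fun w => g w * f w) := fun hg hf =>
    ⟨hg.mul hf.1, VO.mul hU hp hg hf.1 hf.2⟩
  have hmul' : ∀ {g f : Wsp n m → ℂ}, DifferentiableOn ℂ g U → HV U p (k+1) f →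
      HV U p (k+1) (fun w => f w * g w) := fun {g f} hg hf => by
    have := hmul hg hf
    simpa only [mul_comm] using this
  have hsum : ∀ {N : ℕ} {f : Fin N → Wsp n m → ℂ}, (∀ s, HV U p (k+1) (f s)) →
      HV U p (k+1) (fun w => ∑ s, f s w) := fun hf =>
    ⟨DifferentiableOn.fun_sum fun s _ => (hf s).1,
      VO.sum hU hp _ (fun s _ => (hf s).1) (fun s _ => (hf s).2)⟩
  have hcongr : ∀ {f g : Wsp n m → ℂ}, HV U p (k+1) f → EqOn f g U → HV U p (k+1) g :=
    fun hf h => ⟨hf.1.congr fun w hw => (h hw).symm, VO.congr hU hp hf.2 h⟩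
  have hc : ∀ c : ℂ, DifferentiableOn ℂ (fun _ : Wsp n m => c) U := fun c =>
    differentiableOn_const c
  -- vanishing of jets
  have hθV : ∀ s, VO p (k+2) (θ s) := fun s => VO.clm hU hp hX hV (cx n m s)
  have hηV : ∀ s, VO p (k+2) (η s) := fun s => VO.clm hU hp hX hV (cu n m s)
  have hθ0 : ∀ s, HV U p (k+1) (θ s) := fun s => ⟨hθ s, (hθV s).mono (by omega)⟩
  have hη0 : ∀ s, HV U p (k+1) (η s) := fun s => ⟨hη s, (hηV s).mono (by omega)⟩
  have hθ1 : ∀ s v, HV U p (k+1) (pd v (θ s)) := fun s v => ⟨pd_hol hU (hθ s) v, (hθV s).pd v⟩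
  have hη1 : ∀ s v, HV U p (k+1) (pd v (η s)) := fun s v => ⟨pd_hol hU (hη s) v, (hηV s).pd v⟩
  have heta1 : ∀ μ i, HV U p (k+1) (fun w => eta1 θ η μ i (w, q)) := by
    intro μ i
    simp only [eta1_eq]
    exact hsub (hη1 _ _) (hsum fun s => hmul' (hc _) (hθ1 _ _))
  have hpr : ∀ {f : Psp n m → ℂ}, DifferentiableOn ℂ f (U ×ˢ Q) →
      DifferentiableOn ℂ (fun w => f (w, q)) U := by
    intro f hf
    exact hf.comp (f := fun w : Wsp n m => ((w, q) : Psp n m)) (by fun_prop)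
      (fun w hw => ⟨hw, hq⟩)
  have hF0 : ∀ i j k, DifferentiableOn ℂ (fun w => F i j k (w, q)) U := fun i j k => hpr (hF i j k)
  have hF1 : ∀ i j k d, DifferentiableOn ℂ (fun w => fderiv ℂ (F i j k) (w, q) d) U :=
    fun i j k d => hpr (hol_pd (hU.prod hQ) (hF i j k) d)
  have hdq : ∀ k' l', HV U p (k+1)
      (fun w => fderiv ℂ (eta1 θ η μ i) (w, q) (dirq n m k' l')) := by
    intro k' l'
    have := hsub (hη1 μ ((0, fun k => (Pi.single k' (Pi.single l' 1) : Jsp n m) k i) : Wsp n m))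
      (hsum fun s => hadd (hmul' (hc (q μ s)) (hθ1 s
        ((0, fun k => (Pi.single k' (Pi.single l' 1) : Jsp n m) k i) : Wsp n m)))
        (hmul' (hc ((Pi.single k' (Pi.single l' 1) : Jsp n m) μ s)) (hθ1 s (wv q i))))
    refine hcongr this fun w hw => ?_
    exact (eta1_right hU hθ hη μ i hw q _).symm
  have hlead : HV U p (k+1) (pd (wv q j) (fun w => eta1 θ η μ i (w, q))) := by
    have h1 := hadd (hadd (hsum fun s => hmul' (hF1 i j μ (dirx n m s)) (hθ0 s))
      (hsum fun s => hmul' (hF1 i j μ (diru n m s)) (hη0 s)))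
      (hsum fun s => hsum fun t => hmul' (hF1 i j μ (dirq n m s t)) (heta1 s t))
    have h2 := hsub (hadd h1 (hsum fun s => hmul' (hF0 i s μ) (hθ1 s (wv q j))))
      (hsum fun s => hsum fun t => hmul (hF0 j t s) (hdq s t))
    refine hcongr h2 fun w hw => ?_
    have e := hsym (w, q) ⟨hw, hq⟩ i j μ
    unfold eta2 at e
    rw [DtotF_eq hU F hθ hη μ i j hw q] at e
    simp only [Dtot_eq] at e
    linear_combination -e
  have h3 := hlead.2 l hl
  have h4 : EqOn (fun w => eta1 θ η μ i (w, q)) (fun w => Lam q μ (pd (wv q i) (Xf θ η) w)) U := by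
    intro w hw
    simp only [eta1_eq, Lam_apply]
    congr 1
    · exact pd_clm hU hX (cu n m μ) (wv q i) hw
    · refine Finset.sum_congr rfl fun s _ => ?_
      congr 1
      exact pd_clm hU hX (cx n m s) (wv q i) hw
  have h5 := pdl_congr hU (wv q j :: l) h4 hp
  have h6 := pdl_clm hU (Lam q μ) (wv q j :: l) (pd_hol hU hX (wv q i)) hp
  exact (h6.symm.trans h5.symm).trans h3

/-- second order part as a bilinear map -/
def TT {U : Set (Wsp n m)} (hU : IsOpen U) {p : Wsp n m} (hp : p ∈ U) {X : Wsp n m → Wsp n m}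
    (hX : DifferentiableOn ℂ X U) (l : List (Wsp n m)) :
    Wsp n m →ₗ[ℂ] Wsp n m →ₗ[ℂ] Wsp n m :=
  LinearMap.mk₂ ℂ (fun a b => pdl l (pd a (pd b X)) p)
    (by
      intro a a' b
      have : pd (a + a') (pd b X) = fun w => pd a (pd b X) w + pd a' (pd b X) w := by
        funext w; simp [pd]
      rw [this]
      exact pdl_add hU l (pd_hol hU (pd_hol hU hX b) a) (pd_hol hU (pd_hol hU hX b) a') hp)
    (by
      intro c a b
      have : pd (c • a) (pd b X) = fun w => (c • ContinuousLinearMap.id ℂ (Wsp n m))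
          (pd a (pd b X) w) := by
        funext w; simp [pd]
      rw [this, pdl_clm hU _ l (pd_hol hU (pd_hol hU hX b) a) hp]
      simp)
    (by
      intro a b b'
      have : pd (b + b') X = fun w => pd b X w + pd b' X w := by
        funext w; simp [pd]
      rw [this]
      exact (pdl_congr hU l (pd_add hU (pd_hol hU hX b) (pd_hol hU hX b') a) hp).trans
        (pdl_add hU l (pd_hol hU (pd_hol hU hX b) a) (pd_hol hU (pd_hol hU hX b') a) hp))
    (by
      intro c a b
      have : pd (c • b) X = fun w => (c • ContinuousLinearMap.id ℂ (Wsp n m)) (pd b X w) := by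
        funext w; simp [pd]
      rw [this]
      have h := pdl_clm hU (c • ContinuousLinearMap.id ℂ (Wsp n m)) (a :: l) (pd_hol hU hX b) hp
      simpa [pdl] using h)

theorem TT_apply {U : Set (Wsp n m)} (hU : IsOpen U) {p : Wsp n m} (hp : p ∈ U)
    {X : Wsp n m → Wsp n m} (hX : DifferentiableOn ℂ X U) (l : List (Wsp n m)) (a b : Wsp n m) :
    TT hU hp hX l a b = pdl l (pd a (pd b X)) p := rfl

theorem TT_symm {U : Set (Wsp n m)} (hU : IsOpen U) {p : Wsp n m} (hp : p ∈ U)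
    {X : Wsp n m → Wsp n m} (hX : DifferentiableOn ℂ X U) (l : List (Wsp n m)) (a b : Wsp n m) :
    TT hU hp hX l a b = TT hU hp hX l b a := by
  rw [TT_apply, TT_apply]
  exact pdl_congr hU l (fun w hw => pd_comm hU hX hw a b) hp

theorem TT_symm' {U : Set (Wsp n m)} (hU : IsOpen U) {p : Wsp n m} (hp : p ∈ U)
    {X : Wsp n m → Wsp n m} (hX : DifferentiableOn ℂ X U) (l : List (Wsp n m)) (v a b : Wsp n m) :
    TT hU hp hX (v :: l) a b = TT hU hp hX (a :: l) v b := by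
  rw [TT_apply, TT_apply]
  exact pdl_congr hU l (fun w hw => pd_comm hU (pd_hol hU hX b) hw v a) hp

theorem clm_zero_of_dirw {G : Type*} [NormedAddCommGroup G] [NormedSpace ℂ G]
    (M : Wsp n m →L[ℂ] G) (h : ∀ s, M (dirw n m s) = 0) (v : Wsp n m) : M v = 0 := by
  have hv : v = ∑ i, v.1 i • dirw n m (Sum.inl i) + ∑ k, v.2 k • dirw n m (Sum.inr k) := by
    ext k <;> simp [dirw, Prod.fst_sum, Prod.snd_sum, Finset.sum_apply, Pi.single_apply]
  rw [hv]
  simp [map_add, map_sum, h]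

end Main

/-- Let the holomorphic completely overdetermined second order system
`(S_F)` be involutive.  If `(θ, η)` is an infinitesimal symmetry of `(S_F)` whose initial
data `ω(p)` (the values `θ_j(p)`, `η^μ(p)`, all their first order partial derivatives at
`p`, and the second order derivatives `∂²θ_1/∂x_1∂w_s(p)`) vanishes at some point `p ∈ U`,
then `θ ≡ 0` and `η ≡ 0` on `U`.  Consequently the linear map sending an infinitesimal
symmetry to its initial data `ω(p) ∈ ℂ^{(n+m+2)(n+m)}` is injective. -/
theorem statement0 {n m : ℕ}
    (U : Set (Wsp (n + 1) (m + 1))) (Q : Set (Jsp (n + 1) (m + 1)))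
    (hUo : IsOpen U) (hUc : IsConnected U)
    (hQo : IsOpen Q) (hQc : IsConnected Q)
    (F : Fin (n + 1) → Fin (n + 1) → Fin (m + 1) → Psp (n + 1) (m + 1) → ℂ)
    (hF : ∀ i j k, DifferentiableOn ℂ (F i j k) (U ×ˢ Q))
    (hFsym : ∀ i j k, F i j k = F j i k)
    (hinv : IsInvolutive U Q F)
    (θ : Fin (n + 1) → Wsp (n + 1) (m + 1) → ℂ)
    (η : Fin (m + 1) → Wsp (n + 1) (m + 1) → ℂ)
    (hθ : ∀ j, DifferentiableOn ℂ (θ j) U)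
    (hη : ∀ μ, DifferentiableOn ℂ (η μ) U)
    (hsym : IsSymmetry U Q F θ η)
    (p : Wsp (n + 1) (m + 1)) (hp : p ∈ U)
    (hω0 : ∀ j, θ j p = 0)
    (hω0' : ∀ μ, η μ p = 0)
    (hω1 : ∀ j s, fderiv ℂ (θ j) p (dirw (n + 1) (m + 1) s) = 0)
    (hω1' : ∀ μ s, fderiv ℂ (η μ) p (dirw (n + 1) (m + 1) s) = 0)
    (hω2 : ∀ s, fderiv ℂ
        (fun w => fderiv ℂ (θ 0) w (dirw (n + 1) (m + 1) (Sum.inl 0))) p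
        (dirw (n + 1) (m + 1) s) = 0) :
    ∀ w ∈ U, (∀ j, θ j w = 0) ∧ (∀ μ, η μ w = 0) := by
  have hX := Xf_hol hθ hη
  have hsuff : ∀ k, VO p (k+2) (Xf θ η) := by
    intro k
    induction k with
    | zero =>
      intro l hl
      match l, hl with
      | [], _ =>
        show Xf θ η p = 0
        ext j
        · exact hω0 j
        · exact hω0' j
      | [v], _ =>
        show pd v (Xf θ η) p = 0
        ext j
        · have h1 : pd v (θ j) p = (pd v (Xf θ η) p).1 j := pd_clm hUo hX (cx _ _ j) v hp
          rw [← h1]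
          exact clm_zero_of_dirw _ (hω1 j) v
        · have h1 : pd v (η j) p = (pd v (Xf θ η) p).2 j := pd_clm hUo hX (cu _ _ j) v hp
          rw [← h1]
          exact clm_zero_of_dirw _ (hω1' j) v
      | _ :: _ :: _, hl => simp at hl
    | succ k ih =>
      have hpar : ∀ l : List (Wsp (n+1) (m+1)), l.length < k + 1 → ∀ a,
          ∃ c : ℂ, TT hUo hp hX l a a = c • a := by
        intro l hl a
        refine alg_par (TT hUo hp hX l) Q hQo hQc.nonempty ?_ a
        intro q hq i j μ
        rw [← Lam_apply]
        exact leading hUo hQo F hF hθ hη hsym hp ih hq j i μ l hl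
      have hzero : ∀ l : List (Wsp (n+1) (m+1)), l.length = k → ∀ a b,
          TT hUo hp hX l a b = 0 := by
        intro l hl a b
        match l, hl with
        | [], hl =>
          refine alg_second _ (TT_symm hUo hp hX []) (hpar [] (by simp))
            (dirw (n+1) (m+1) (Sum.inl 0)) (cx (n+1) (m+1) 0).toLinearMap ?_ ?_ a b
          · simp [cx, dirw]
          · intro b
            rw [TT_symm, TT_apply]
            show cx (n+1) (m+1) 0 (pd b (pd (dirw (n+1) (m+1) (Sum.inl 0)) (Xf θ η)) p) = 0
            have h1 := pdl_clm hUo (cx (n+1) (m+1) 0) [dirw (n+1) (m+1) (Sum.inl 0), b] hX hp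
            exact h1.symm.trans (clm_zero_of_dirw _ hω2 b)
        | v :: l', hl =>
          exact alg_third wsp_dim (fun v => TT hUo hp hX (v :: l'))
            (fun v => TT_symm hUo hp hX (v :: l')) (fun v => TT_symm' hUo hp hX l' v)
            (fun v => hpar (v :: l') (by simp at hl ⊢; omega)) v a b
      intro l hl
      rcases Nat.lt_or_ge l.length (k+2) with h | h
      · exact ih l h
      · match l, h, hl with
        | a :: b :: l', h, hl =>
          have := hzero l' (by simp at h hl; omega) b a
          rw [TT_apply] at this
          exact this
  have hall : ∀ k, VO p k (Xf θ η) := fun k => (hsuff k).mono (by omega)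
  intro w hw
  have h0 := eq_zero_of_VO hUo hUc.isPreconnected hp hX hall w hw
  exact ⟨fun j => congrFun (congrArg Prod.fst h0) j, fun μ => congrFun (congrArg Prod.snd h0) μ⟩
end
end

section
/- If X = (θ, η) and Y = (θ', η') are infinitesimal symmetries of the system (S_F), then so is their Lie bracket [X, Y], the holomorphic vector field on U whose value at w ∈ U is DY(w)(X(w)) − DX(w)(Y(w)), where X and Y are viewed as holomorphic maps U → ℂ^{n+m}. Hence the set Lie(S_F) of infinitesimal symmetries of (S_F) is a complex Lie algebra under the bracket. -/
open scoped BigOperators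

noncomputable section

/-- The holomorphic vector field `X = Σ_j θ_j ∂/∂x_j + Σ_μ η^μ ∂/∂u^μ` viewed as a
holomorphic map `U → ℂ^{n+m}`. -/
def toField {n m : ℕ} (θ : Fin n → Wsp n m → ℂ) (η : Fin m → Wsp n m → ℂ)
    (w : Wsp n m) : Wsp n m :=
  (fun j => θ j w, fun μ => η μ w)

/-- The Lie bracket `[X, Y](w) = DY(w)(X(w)) − DX(w)(Y(w))` of two holomorphic
vector fields viewed as maps `U → ℂ^{n+m}`. -/
def bracket {n m : ℕ} (X Y : Wsp n m → Wsp n m) (w : Wsp n m) : Wsp n m :=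
  fderiv ℂ Y w (X w) - fderiv ℂ X w (Y w)

open Metric Set MeasureTheory Filter Topology

theorem holo_dir {E : Type*} [NormedAddCommGroup E] [NormedSpace ℂ E] [FiniteDimensional ℂ E]
    {f : E → ℂ} {s : Set E} (hs : IsOpen s) (hf : DifferentiableOn ℂ f s) (v : E) :
    DifferentiableOn ℂ (fun x => fderiv ℂ f x v) s := by
  let _ : MeasurableSpace E := borel E
  have : BorelSpace E := ⟨rfl⟩
  have : ProperSpace E := FiniteDimensional.proper ℂ E
  intro x₀ hx₀
  apply DifferentiableAt.differentiableWithinAt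
  -- a ball where f is bounded
  obtain ⟨R, hR, hball⟩ : ∃ R > 0, ∀ x ∈ ball x₀ (3 * R), x ∈ s ∧ dist (f x) (f x₀) < 1 := by
    have h1 : ∀ᶠ x in 𝓝 x₀, x ∈ s ∧ dist (f x) (f x₀) < 1 :=
      (hs.eventually_mem hx₀).and
        (((hf x₀ hx₀).differentiableAt (hs.mem_nhds hx₀)).continuousAt.eventually
          (Metric.ball_mem_nhds _ one_pos))
    obtain ⟨ε, hε, h⟩ := Metric.eventually_nhds_iff_ball.1 h1
    exact ⟨ε / 3, by positivity, fun x hx => h x (by convert hx using 2; ring)⟩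
  have hdiff : ∀ x ∈ ball x₀ (3 * R), DifferentiableAt ℂ f x := fun x hx =>
    (hf x (hball x hx).1).differentiableAt (hs.mem_nhds (hball x hx).1)
  have hbd : ∀ x ∈ ball x₀ (2 * R), ‖fderiv ℂ f x‖ ≤ 2 / R := by
    intro x hx
    have hsub : ball x R ⊆ ball x₀ (3 * R) := by
      apply ball_subset_ball'
      have := mem_ball.1 hx
      linarith
    apply Complex.norm_fderiv_le_div_of_mapsTo_ball
      (fun y hy => (hdiff y (hsub hy)).differentiableWithinAt) _ hR
    intro y hy
    have h1 := (hball y (hsub hy)).2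
    have h2 := (hball x (hsub (mem_ball_self hR))).2
    rw [mem_closedBall]
    have := dist_triangle_right (f y) (f x) (f x₀)
    linarith
  obtain ⟨r, hr, hrv⟩ : ∃ r > 0, r * ‖v‖ < R := by
    refine ⟨R / (‖v‖ + 1), by positivity, ?_⟩
    rw [div_mul_eq_mul_div, div_lt_iff₀ (by positivity)]
    nlinarith
  have hmem : ∀ x ∈ ball x₀ R, ∀ z ∈ closedBall (0:ℂ) r, x + z • v ∈ ball x₀ (2 * R) := by
    intro x hx z hz
    rw [mem_ball, dist_eq_norm] at *
    rw [mem_closedBall, dist_zero_right] at hz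
    calc ‖x + z • v - x₀‖ = ‖(x - x₀) + z • v‖ := by congr 1; abel
      _ ≤ ‖x - x₀‖ + ‖z‖ * ‖v‖ := (norm_add_le _ _).trans (by rw [norm_smul])
      _ < 2 * R := by
        have := mul_le_mul_of_nonneg_right hz (norm_nonneg v)
        linarith
  have h23 : ball x₀ (2 * R) ⊆ ball x₀ (3 * R) := ball_subset_ball (by linarith)
  have hcirc : ∀ t, circleMap 0 r t ∈ closedBall (0:ℂ) r := fun t =>
    circleMap_mem_closedBall 0 hr.le t
  let w : ℝ → ℂ := fun t => deriv (circleMap 0 r) t * (1 / (circleMap 0 r t - 0) ^ 2)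
  have hw : Continuous w := by
    have h0 : ∀ t, (circleMap 0 r t - 0) ^ 2 ≠ 0 := fun t => by
      simp [circleMap, hr.ne']
    have h1 : Continuous (deriv (circleMap 0 r)) := by
      simp only [funext (deriv_circleMap 0 r)]
      fun_prop
    have := (continuous_circleMap 0 r)
    exact h1.mul (continuous_const.div (by fun_prop) h0)
  have key : ∀ x ∈ ball x₀ R, fderiv ℂ f x v =
      (2 * Real.pi * Complex.I)⁻¹ *
        ∫ t in Ioc 0 (2 * Real.pi), w t * f (x + circleMap 0 r t • v) := by
    intro x hx
    have hg : ∀ z ∈ closedBall (0:ℂ) r, DifferentiableAt ℂ (fun z : ℂ => f (x + z • v)) z := by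
      intro z hz
      have := hdiff _ (h23 (hmem x hx z hz))
      exact this.comp z (by fun_prop)
    have h1 := DiffContOnCl.deriv_eq_smul_circleIntegral (f := fun z : ℂ => f (x + z • v)) hr
      (c := 0) ((DifferentiableOn.diffContOnCl_ball (U := closedBall 0 r)
        (fun z hz => (hg z hz).differentiableWithinAt) le_rfl))
    have h2 : deriv (fun z : ℂ => f (x + z • v)) 0 = fderiv ℂ f x v := by
      have hfx : HasFDerivAt f (fderiv ℂ f x) (x + (0:ℂ) • v) := by
        simpa using (hdiff x (ball_subset_ball (by linarith) hx)).hasFDerivAt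
      have hl : HasDerivAt (fun z : ℂ => x + z • v) v 0 := by
        simpa using ((hasDerivAt_id (0:ℂ)).smul_const v).const_add x
      exact (hfx.comp_hasDerivAt 0 hl).deriv
    rw [h2, circleIntegral, intervalIntegral.integral_of_le (by positivity)] at h1
    rw [smul_eq_mul] at h1
    rw [eq_inv_mul_iff_mul_eq₀ (by simp [Real.pi_ne_zero]), ← h1]
    congr 1
    ext t
    simp [w, mul_assoc]
  have hint : HasFDerivAt (fun x => ∫ t in Ioc 0 (2 * Real.pi), w t * f (x + circleMap 0 r t • v))
      (∫ t in Ioc 0 (2 * Real.pi), w t • fderiv ℂ f (x₀ + circleMap 0 r t • v)) x₀ := by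
    have hcont : ∀ x ∈ ball x₀ R, Continuous fun t => w t * f (x + circleMap 0 r t • v) := by
      intro x hx
      refine hw.mul (continuous_iff_continuousAt.2 fun t => ?_)
      have h1 := (hdiff _ (h23 (hmem x hx _ (hcirc t)))).continuousAt
      have h2 : ContinuousAt (fun t => x + circleMap 0 r t • v) t := by
        have := (continuous_circleMap 0 r)
        fun_prop
      exact ContinuousAt.comp (f := fun t => x + circleMap 0 r t • v) h1 h2
    apply hasFDerivAt_integral_of_dominated_of_fderiv_le (ball_mem_nhds x₀ hR)
      (bound := fun t => ‖w t‖ * (2 / R))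
      (F' := fun x t => w t • fderiv ℂ f (x + circleMap 0 r t • v))
    · filter_upwards [ball_mem_nhds x₀ hR] with x hx
      exact (hcont x hx).aestronglyMeasurable
    · exact ((hcont x₀ (mem_ball_self hR)).integrableOn_Icc).mono_set Ioc_subset_Icc_self
    · have h1 : Measurable fun t => fderiv ℂ f (x₀ + circleMap 0 r t • v) := by
        have h2 : Continuous (fun t => x₀ + circleMap 0 r t • v) := by
          have := (continuous_circleMap 0 r)
          fun_prop
        exact (measurable_fderiv ℂ f).comp h2.measurable
      exact (hw.measurable.smul h1).aestronglyMeasurable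
    · refine Eventually.of_forall fun t x hx => ?_
      rw [norm_smul]
      exact mul_le_mul_of_nonneg_left (hbd _ (hmem x hx _ (hcirc t))) (norm_nonneg _)
    · exact (((hw.norm.mul continuous_const)).integrableOn_Icc).mono_set Ioc_subset_Icc_self
    · refine Eventually.of_forall fun t x hx => ?_
      have h1 := (hdiff _ (h23 (hmem x hx _ (hcirc t)))).hasFDerivAt
      have h2 : HasFDerivAt (fun x => x + circleMap 0 r t • v) (ContinuousLinearMap.id ℂ E) x :=
        (hasFDerivAt_id x).add_const _
      exact (HasFDerivAt.comp (f := fun x => x + circleMap 0 r t • v) x h1 h2).const_mul (w t)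
  refine ((hint.differentiableAt.const_mul (2 * Real.pi * Complex.I)⁻¹).congr_of_eventuallyEq ?_)
  filter_upwards [ball_mem_nhds x₀ hR] with x hx
  exact key x hx

theorem holo_contDiffOn {E : Type*} [NormedAddCommGroup E] [NormedSpace ℂ E]
    [FiniteDimensional ℂ E] {s : Set E} (hs : IsOpen s) (N : ℕ) :
    ∀ {f : E → ℂ}, DifferentiableOn ℂ f s → ContDiffOn ℂ N f s := by
  induction N with
  | zero => intro f hf; exact contDiffOn_zero.2 hf.continuousOn
  | succ N ih =>
    intro f hf
    push_cast
    rw [contDiffOn_succ_iff_fderiv_of_isOpen hs]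
    refine ⟨hf, by simp, ?_⟩
    rw [contDiffOn_clm_apply]
    exact fun v => ih (holo_dir hs hf v)

open VectorField

/-- The first prolongation of the vector field `(θ, η)` to the jet space. -/
def prol {n m : ℕ} (θ : Fin n → Wsp n m → ℂ) (η : Fin m → Wsp n m → ℂ) (p : Psp n m) :
    Psp n m :=
  ((toField θ η p.1), fun μ i => eta1 θ η μ i p)

section components
variable {n m : ℕ} (F : Fin n → Fin n → Fin m → Psp n m → ℂ)

theorem fderiv_Z (φ : Psp n m → ℂ) (i : Fin n) (p : Psp n m) :
    fderiv ℂ φ p (Zfield F i p) = DtotF F φ i p := by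
  simp [Zfield, DtotF, map_add, map_sum, map_smul]

theorem Z_x (i k : Fin n) (p : Psp n m) :
    (Zfield F i p).1.1 k = (Pi.single i 1 : Fin n → ℂ) k := by
  simp [Zfield, dirx, diru, dirq, Prod.fst_sum, Prod.snd_sum]

theorem Z_u (i : Fin n) (k : Fin m) (p : Psp n m) :
    (Zfield F i p).1.2 k = p.2 k i := by
  simp [Zfield, dirx, diru, dirq, Prod.fst_sum, Prod.snd_sum, Pi.single_apply]

theorem Z_q (i j : Fin n) (k : Fin m) (p : Psp n m) :
    (Zfield F i p).2 k j = F i j k p := by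
  simp [Zfield, dirx, diru, dirq, Prod.fst_sum, Prod.snd_sum, Pi.single_apply, Finset.sum_apply,
    ite_apply]

theorem Dtot_eq_s2 (ψ : Wsp n m → ℂ) (i : Fin n) (p : Psp n m) :
    Dtot ψ i p = fderiv ℂ ψ p.1 (Zfield F i p).1 := by
  have : (Zfield F i p).1 = ((Pi.single i 1 : Fin n → ℂ), (0 : Fin m → ℂ))
      + ∑ k, p.2 k i • ((0 : Fin n → ℂ), (Pi.single k 1 : Fin m → ℂ)) := by
    simp [Zfield, dirx, diru, dirq, Prod.fst_sum]
  rw [this, map_add, map_sum]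
  simp only [map_smul, smul_eq_mul, Dtot]

theorem fderiv_base {G : Type*} [NormedAddCommGroup G] [NormedSpace ℂ G]
    (ψ : Wsp n m → G) (p v : Psp n m) (h : DifferentiableAt ℂ ψ p.1) :
    fderiv ℂ (fun q : Psp n m => ψ q.1) p v = fderiv ℂ ψ p.1 v.1 := by
  have h1 : HasFDerivAt (fun q : Psp n m => ψ q.1)
      ((fderiv ℂ ψ p.1).comp (ContinuousLinearMap.fst ℂ (Wsp n m) (Jsp n m))) p :=
    h.hasFDerivAt.comp p hasFDerivAt_fst
  rw [h1.fderiv]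
  rfl

theorem fderiv_expand (φ : Psp n m → ℂ) (p v : Psp n m) :
    fderiv ℂ φ p v = (∑ s, v.1.1 s * fderiv ℂ φ p (dirx n m s))
      + (∑ k, v.1.2 k * fderiv ℂ φ p (diru n m k))
      + (∑ k, ∑ l, v.2 k l * fderiv ℂ φ p (dirq n m k l)) := by
  have : v = (∑ s, v.1.1 s • dirx n m s) + (∑ k, v.1.2 k • diru n m k)
      + (∑ k, ∑ l, v.2 k l • dirq n m k l) := by
    refine Prod.ext (Prod.ext ?_ ?_) ?_
    · ext s
      simp [dirx, diru, dirq, Prod.fst_sum, Prod.snd_sum, Pi.single_apply]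
    · ext s
      simp [dirx, diru, dirq, Prod.fst_sum, Prod.snd_sum, Pi.single_apply]
    · ext k l
      simp [dirx, diru, dirq, Prod.fst_sum, Prod.snd_sum, Pi.single_apply, Finset.sum_apply,
        ite_apply]
  conv_lhs => rw [this]
  simp [map_add, map_sum, map_smul]

theorem clm_fderiv {E G H : Type*} [NormedAddCommGroup E] [NormedSpace ℂ E]
    [NormedAddCommGroup G] [NormedSpace ℂ G] [NormedAddCommGroup H] [NormedSpace ℂ H]
    (L : G →L[ℂ] H) {W : E → G} {p : E} (h : DifferentiableAt ℂ W p) (v : E) :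
    L (fderiv ℂ W p v) = fderiv ℂ (fun q => L (W q)) p v := by
  have h1 : HasFDerivAt (fun q => L (W q)) (L.comp (fderiv ℂ W p)) p :=
    L.hasFDerivAt.comp p h.hasFDerivAt
  rw [h1.fderiv]
  rfl

/-- coordinate functionals -/
def Lx (n m : ℕ) (k : Fin n) : Psp n m →L[ℂ] ℂ :=
  (ContinuousLinearMap.proj k).comp ((ContinuousLinearMap.fst ℂ _ _).comp
    (ContinuousLinearMap.fst ℂ (Wsp n m) (Jsp n m)))

def Lu (n m : ℕ) (k : Fin m) : Psp n m →L[ℂ] ℂ :=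
  (ContinuousLinearMap.proj k).comp ((ContinuousLinearMap.snd ℂ _ _).comp
    (ContinuousLinearMap.fst ℂ (Wsp n m) (Jsp n m)))

def Lq (n m : ℕ) (k : Fin m) (i : Fin n) : Psp n m →L[ℂ] ℂ :=
  (ContinuousLinearMap.proj (R := ℂ) (φ := fun _ : Fin n => ℂ) i).comp
    ((ContinuousLinearMap.proj (R := ℂ) (φ := fun _ : Fin m => Fin n → ℂ) k).comp
    (ContinuousLinearMap.snd ℂ (Wsp n m) (Jsp n m)))

theorem br_x {W : Psp n m → Psp n m} {p : Psp n m} {j : Fin n}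
    (hZ : DifferentiableAt ℂ (Zfield F j) p) (hW : DifferentiableAt ℂ W p) (k : Fin n) :
    (lieBracket ℂ (Zfield F j) W p).1.1 k
      = fderiv ℂ (fun q => (W q).1.1 k) p (Zfield F j p) := by
  have h1 := clm_fderiv (Lx n m k) hW (Zfield F j p)
  have h2 := clm_fderiv (Lx n m k) hZ (W p)
  have h3 : (fun q => Lx n m k (Zfield F j q)) = fun _ => (Pi.single j 1 : Fin n → ℂ) k :=
    funext fun q => Z_x F j k q
  rw [h3, fderiv_fun_const] at h2
  change Lx n m k (_ - _) = _
  rw [map_sub, h1, h2]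
  simp [Lx]

theorem br_u {W : Psp n m → Psp n m} {p : Psp n m} {j : Fin n}
    (hZ : DifferentiableAt ℂ (Zfield F j) p) (hW : DifferentiableAt ℂ W p) (k : Fin m) :
    (lieBracket ℂ (Zfield F j) W p).1.2 k
      = fderiv ℂ (fun q => (W q).1.2 k) p (Zfield F j p) - (W p).2 k j := by
  have h1 := clm_fderiv (Lu n m k) hW (Zfield F j p)
  have h2 := clm_fderiv (Lu n m k) hZ (W p)
  have h3 : (fun q => Lu n m k (Zfield F j q)) = fun q => Lq n m k j q :=
    funext fun q => Z_u F j k q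
  rw [h3, ContinuousLinearMap.fderiv] at h2
  change Lu n m k (_ - _) = _
  rw [map_sub, h1, h2]
  rfl

theorem br_q {W : Psp n m → Psp n m} {p : Psp n m} {j : Fin n}
    (hZ : DifferentiableAt ℂ (Zfield F j) p) (hW : DifferentiableAt ℂ W p) (k : Fin m)
    (i : Fin n) :
    (lieBracket ℂ (Zfield F j) W p).2 k i
      = fderiv ℂ (fun q => (W q).2 k i) p (Zfield F j p) - fderiv ℂ (F j i k) p (W p) := by
  have h1 := clm_fderiv (Lq n m k i) hW (Zfield F j p)
  have h2 := clm_fderiv (Lq n m k i) hZ (W p)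
  have h3 : (fun q => Lq n m k i (Zfield F j q)) = F j i k :=
    funext fun q => Z_q F j i k q
  rw [h3] at h2
  change Lq n m k i (_ - _) = _
  rw [map_sub, h1, h2]
  rfl

theorem sumZ_x (c : Fin n → ℂ) (p : Psp n m) (k : Fin n) :
    (∑ l, c l • Zfield F l p).1.1 k = c k := by
  simp [Prod.fst_sum, Finset.sum_apply, Z_x, Pi.single_apply]

theorem sumZ_u (c : Fin n → ℂ) (p : Psp n m) (k : Fin m) :
    (∑ l, c l • Zfield F l p).1.2 k = ∑ l, c l * p.2 k l := by
  simp [Prod.fst_sum, Prod.snd_sum, Finset.sum_apply, Z_u]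

theorem sumZ_q (c : Fin n → ℂ) (p : Psp n m) (k : Fin m) (i : Fin n) :
    (∑ l, c l • Zfield F l p).2 k i = ∑ l, c l * F l i k p := by
  simp [Prod.snd_sum, Finset.sum_apply, Z_q]

/-- the determining identity at a point is a Lie bracket identity -/
theorem sym_iff (hFsym : ∀ i j k, F i j k = F j i k)
    {θ : Fin n → Wsp n m → ℂ} {η : Fin m → Wsp n m → ℂ} {p : Psp n m}
    (hθ : ∀ k, DifferentiableAt ℂ (θ k) p.1) (hη : ∀ k, DifferentiableAt ℂ (η k) p.1)
    (hZ : ∀ j, DifferentiableAt ℂ (Zfield F j) p)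
    (hP : DifferentiableAt ℂ (prol θ η) p) :
    (∀ (i j : Fin n) (μ : Fin m), eta2 F θ η μ i j p =
      (∑ s, θ s p.1 * fderiv ℂ (F i j μ) p (dirx n m s))
      + (∑ k, η k p.1 * fderiv ℂ (F i j μ) p (diru n m k))
      + (∑ k, ∑ l, eta1 θ η k l p * fderiv ℂ (F i j μ) p (dirq n m k l))) ↔
    ∀ j, lieBracket ℂ (Zfield F j) (prol θ η) p = ∑ k, Dtot (θ k) j p • Zfield F k p := by
  have e1 : ∀ i j μ, (∑ s, θ s p.1 * fderiv ℂ (F i j μ) p (dirx n m s))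
      + (∑ k, η k p.1 * fderiv ℂ (F i j μ) p (diru n m k))
      + (∑ k, ∑ l, eta1 θ η k l p * fderiv ℂ (F i j μ) p (dirq n m k l))
      = fderiv ℂ (F i j μ) p (prol θ η p) := fun i j μ =>
    (fderiv_expand (F i j μ) p (prol θ η p)).symm
  have hq : ∀ i j μ, (lieBracket ℂ (Zfield F j) (prol θ η) p).2 μ i
      = DtotF F (eta1 θ η μ i) j p - fderiv ℂ (F i j μ) p (prol θ η p) := by
    intro i j μ
    rw [br_q F (hZ j) hP, fderiv_Z, hFsym j i μ]
    rfl
  have hs : ∀ i j μ, (∑ k, Dtot (θ k) j p • Zfield F k p).2 μ i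
      = ∑ k, Dtot (θ k) j p * F i k μ p := by
    intro i j μ
    rw [sumZ_q]
    exact Finset.sum_congr rfl fun k _ => by rw [hFsym k i μ]
  constructor
  · intro h j
    refine Prod.ext (Prod.ext ?_ ?_) ?_
    · ext k
      rw [br_x F (hZ j) hP, sumZ_x, Dtot_eq_s2 F]
      exact fderiv_base (θ k) p _ (hθ k)
    · ext k
      rw [br_u F (hZ j) hP, sumZ_u]
      have h1 : fderiv ℂ (fun q => (prol θ η q).1.2 k) p (Zfield F j p) = Dtot (η k) j p := by
        rw [Dtot_eq_s2 F]
        exact fderiv_base (η k) p _ (hη k)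
      rw [h1]
      simp [prol, eta1]
    · ext μ i
      rw [hq, hs]
      have := h i j μ
      rw [e1, eta2] at this
      rw [← this]
      ring
  · intro h i j μ
    rw [e1, eta2, ← hs, ← h j, hq]
    ring

end components

section smooth
variable {n m : ℕ}

theorem toField_contDiffAt {N : WithTop ℕ∞} {θ : Fin n → Wsp n m → ℂ} {η : Fin m → Wsp n m → ℂ}
    {w : Wsp n m} (hθ : ∀ k, ContDiffAt ℂ N (θ k) w) (hη : ∀ k, ContDiffAt ℂ N (η k) w) :
    ContDiffAt ℂ N (toField θ η) w :=
  (contDiffAt_pi.2 hθ).prodMk (contDiffAt_pi.2 hη)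

theorem Dtot_contDiffAt {N : ℕ} {ψ : Wsp n m → ℂ} {p : Psp n m}
    (h : ContDiffAt ℂ (N + 1 : ℕ) ψ p.1) (i : Fin n) : ContDiffAt ℂ N (Dtot ψ i) p := by
  have h1 : ∀ v, ContDiffAt ℂ N (fun q : Psp n m => fderiv ℂ ψ q.1 v) p := by
    intro v
    have h2 : ContDiffAt ℂ N (fun w => fderiv ℂ ψ w v) p.1 :=
      (h.fderiv_right (m := N) (by push_cast; exact le_rfl)).clm_apply contDiffAt_const
    exact ContDiffAt.comp (f := Prod.fst) p h2 contDiffAt_fst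
  unfold Dtot
  refine (h1 _).add (ContDiffAt.sum fun k _ => ContDiffAt.mul ?_ (h1 _))
  exact (Lq n m k i).contDiff.contDiffAt

theorem prol_contDiffAt {N : ℕ} {θ : Fin n → Wsp n m → ℂ} {η : Fin m → Wsp n m → ℂ}
    {p : Psp n m} (hθ : ∀ k, ContDiffAt ℂ (N + 1 : ℕ) (θ k) p.1)
    (hη : ∀ k, ContDiffAt ℂ (N + 1 : ℕ) (η k) p.1) : ContDiffAt ℂ N (prol θ η) p := by
  have hle : (N : WithTop ℕ∞) ≤ (N + 1 : ℕ) := by exact_mod_cast Nat.le_succ N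
  refine ContDiffAt.prodMk ?_ (contDiffAt_pi.2 fun μ => contDiffAt_pi.2 fun i => ?_)
  · have := toField_contDiffAt (fun k => (hθ k).of_le hle) (fun k => (hη k).of_le hle)
    exact ContDiffAt.comp (f := Prod.fst) p this contDiffAt_fst
  · unfold eta1
    refine (Dtot_contDiffAt (hη μ) i).sub (ContDiffAt.sum fun k _ =>
      (Dtot_contDiffAt (hθ k) i).mul ?_)
    exact (Lq n m μ k).contDiff.contDiffAt

theorem Z_contDiffAt {N : WithTop ℕ∞} {F : Fin n → Fin n → Fin m → Psp n m → ℂ} {p : Psp n m}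
    (hF : ∀ i j k, ContDiffAt ℂ N (F i j k) p) (i : Fin n) :
    ContDiffAt ℂ N (Zfield F i) p := by
  unfold Zfield
  refine (contDiffAt_const.add (ContDiffAt.sum fun k _ => ?_)).add
    (ContDiffAt.sum fun k _ => ContDiffAt.sum fun j _ => (hF i j k).smul contDiffAt_const)
  exact ((Lq n m k i).contDiff.contDiffAt).smul contDiffAt_const

/-- base component of the bracket of prolongations -/
theorem br_base {θ θ' : Fin n → Wsp n m → ℂ} {η η' : Fin m → Wsp n m → ℂ} {p : Psp n m}
    (hX : DifferentiableAt ℂ (toField θ η) p.1) (hY : DifferentiableAt ℂ (toField θ' η') p.1)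
    (hX' : DifferentiableAt ℂ (prol θ η) p) (hY' : DifferentiableAt ℂ (prol θ' η') p) :
    (lieBracket ℂ (prol θ η) (prol θ' η') p).1 = bracket (toField θ η) (toField θ' η') p.1 := by
  have h1 := clm_fderiv (ContinuousLinearMap.fst ℂ (Wsp n m) (Jsp n m)) hY' (prol θ η p)
  have h2 := clm_fderiv (ContinuousLinearMap.fst ℂ (Wsp n m) (Jsp n m)) hX' (prol θ' η' p)
  change ContinuousLinearMap.fst ℂ (Wsp n m) (Jsp n m) (_ - _) = _
  rw [map_sub, h1, h2]
  have h3 := fderiv_base (toField θ' η') p (prol θ η p) hY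
  have h4 := fderiv_base (toField θ η) p (prol θ' η' p) hX
  exact congrArg₂ (· - ·) h3 h4

end smooth

/-- bracket of a combination of the `Z k` with a field normalising their span -/
theorem span_br_left {E ι : Type*} [Fintype ι] [NormedAddCommGroup E] [NormedSpace ℂ E]
    {Z : ι → E → E} {a : ι → E → ℂ} {V : E → E} {p : E}
    (hZ : ∀ k, DifferentiableAt ℂ (Z k) p) (ha : ∀ k, DifferentiableAt ℂ (a k) p)
    (h : ∀ k, lieBracket ℂ (Z k) V p ∈ Submodule.span ℂ (Set.range fun k => Z k p)) :
    lieBracket ℂ (fun q => ∑ k, a k q • Z k q) V p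
      ∈ Submodule.span ℂ (Set.range fun k => Z k p) := by
  have hd : fderiv ℂ (fun q => ∑ k, a k q • Z k q) p (V p)
      = ∑ k, fderiv ℂ (fun q => a k q • Z k q) p (V p) := by
    rw [fderiv_fun_sum (A := fun k q => a k q • Z k q) fun k _ => (ha k).smul (hZ k)]
    simp
  have : lieBracket ℂ (fun q => ∑ k, a k q • Z k q) V p
      = ∑ k, lieBracket ℂ (fun q => a k q • Z k q) V p := by
    simp only [lieBracket, hd, Finset.sum_sub_distrib, map_sum]
  rw [this]
  refine Submodule.sum_mem _ fun k _ => ?_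
  rw [lieBracket_smul_left (ha k) (hZ k)]
  exact Submodule.add_mem _ (Submodule.smul_mem _ _ (Submodule.subset_span ⟨k, rfl⟩))
    (Submodule.smul_mem _ _ (h k))

/-- If `X = (θ, η)` and `Y = (θ', η')` are infinitesimal symmetries of
the involutive system `(S_F)`, then so is their Lie bracket `[X, Y]`; hence the set
`Lie(S_F)` of infinitesimal symmetries of `(S_F)` is a complex Lie algebra under the
bracket. -/
theorem statement2 {n m : ℕ}
    (U : Set (Wsp (n + 1) (m + 1))) (Q : Set (Jsp (n + 1) (m + 1)))
    (hUo : IsOpen U) (hUc : IsConnected U)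
    (hQo : IsOpen Q) (hQc : IsConnected Q)
    (F : Fin (n + 1) → Fin (n + 1) → Fin (m + 1) → Psp (n + 1) (m + 1) → ℂ)
    (hF : ∀ i j k, DifferentiableOn ℂ (F i j k) (U ×ˢ Q))
    (hFsym : ∀ i j k, F i j k = F j i k)
    (hinv : IsInvolutive U Q F)
    (θ θ' : Fin (n + 1) → Wsp (n + 1) (m + 1) → ℂ)
    (η η' : Fin (m + 1) → Wsp (n + 1) (m + 1) → ℂ)
    (hθ : ∀ j, DifferentiableOn ℂ (θ j) U) (hη : ∀ μ, DifferentiableOn ℂ (η μ) U)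
    (hθ' : ∀ j, DifferentiableOn ℂ (θ' j) U) (hη' : ∀ μ, DifferentiableOn ℂ (η' μ) U)
    (hX : IsSymmetry U Q F θ η) (hY : IsSymmetry U Q F θ' η') :
    (∀ j, DifferentiableOn ℂ
        (fun w => (bracket (toField θ η) (toField θ' η') w).1 j) U)
    ∧ (∀ μ, DifferentiableOn ℂ
        (fun w => (bracket (toField θ η) (toField θ' η') w).2 μ) U)
    ∧ IsSymmetry U Q F
        (fun j w => (bracket (toField θ η) (toField θ' η') w).1 j)
        (fun μ w => (bracket (toField θ η) (toField θ' η') w).2 μ) := by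
  have hS : IsOpen (U ×ˢ Q) := hUo.prod hQo
  have hcU : ∀ {ψ : Wsp (n + 1) (m + 1) → ℂ}, DifferentiableOn ℂ ψ U → ∀ (N : ℕ), ∀ w ∈ U,
      ContDiffAt ℂ N ψ w := fun hψ N w hw =>
    (holo_contDiffOn hUo N hψ).contDiffAt (hUo.mem_nhds hw)
  have hcF : ∀ p ∈ U ×ˢ Q, ∀ i j k, ContDiffAt ℂ (2 : ℕ) (F i j k) p := fun p hp i j k =>
    (holo_contDiffOn hS 2 (hF i j k)).contDiffAt (hS.mem_nhds hp)
  have hcZ : ∀ p ∈ U ×ˢ Q, ∀ j, ContDiffAt ℂ (2 : ℕ) (Zfield F j) p := fun p hp j =>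
    Z_contDiffAt (hcF p hp) j
  have hcX : ∀ p ∈ U ×ˢ Q, ContDiffAt ℂ (2 : ℕ) (prol θ η) p := fun p hp =>
    prol_contDiffAt (fun k => hcU (hθ k) _ p.1 hp.1) (fun k => hcU (hη k) _ p.1 hp.1)
  have hcY : ∀ p ∈ U ×ˢ Q, ContDiffAt ℂ (2 : ℕ) (prol θ' η') p := fun p hp =>
    prol_contDiffAt (fun k => hcU (hθ' k) _ p.1 hp.1) (fun k => hcU (hη' k) _ p.1 hp.1)
  have hZd : ∀ p ∈ U ×ˢ Q, ∀ j, DifferentiableAt ℂ (Zfield F j) p := fun p hp j =>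
    (hcZ p hp j).differentiableAt (by simp)
  have htX : ∀ w ∈ U, ContDiffAt ℂ (2 : ℕ) (toField θ η) w := fun w hw =>
    toField_contDiffAt (fun k => hcU (hθ k) _ w hw) (fun k => hcU (hη k) _ w hw)
  have htY : ∀ w ∈ U, ContDiffAt ℂ (2 : ℕ) (toField θ' η') w := fun w hw =>
    toField_contDiffAt (fun k => hcU (hθ' k) _ w hw) (fun k => hcU (hη' k) _ w hw)
  have hb : ∀ w ∈ U, DifferentiableAt ℂ (bracket (toField θ η) (toField θ' η')) w := by
    intro w hw
    have : ContDiffAt ℂ 1 (lieBracket ℂ (toField θ η) (toField θ' η')) w :=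
      (htX w hw).lieBracket_vectorField (htY w hw) (by norm_num)
    exact this.differentiableAt (by simp)
  have hB1 : ∀ j, DifferentiableOn ℂ
      (fun w => (bracket (toField θ η) (toField θ' η') w).1 j) U := fun j w hw =>
    (differentiableAt_pi.1 (hb w hw).fst j).differentiableWithinAt
  have hB2 : ∀ μ, DifferentiableOn ℂ
      (fun w => (bracket (toField θ η) (toField θ' η') w).2 μ) U := fun j w hw =>
    (differentiableAt_pi.1 (hb w hw).snd j).differentiableWithinAt
  refine ⟨hB1, hB2, ?_⟩
  have hXb : ∀ p ∈ U ×ˢ Q, ∀ j, lieBracket ℂ (Zfield F j) (prol θ η) p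
      = ∑ k, Dtot (θ k) j p • Zfield F k p := fun p hp =>
    (sym_iff F hFsym (fun k => (hcU (hθ k) 1 p.1 hp.1).differentiableAt (by simp))
      (fun k => (hcU (hη k) 1 p.1 hp.1).differentiableAt (by simp)) (hZd p hp)
      ((hcX p hp).differentiableAt (by simp))).1 (hX p hp)
  have hYb : ∀ p ∈ U ×ˢ Q, ∀ j, lieBracket ℂ (Zfield F j) (prol θ' η') p
      = ∑ k, Dtot (θ' k) j p • Zfield F k p := fun p hp =>
    (sym_iff F hFsym (fun k => (hcU (hθ' k) 1 p.1 hp.1).differentiableAt (by simp))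
      (fun k => (hcU (hη' k) 1 p.1 hp.1).differentiableAt (by simp)) (hZd p hp)
      ((hcY p hp).differentiableAt (by simp))).1 (hY p hp)
  set W := lieBracket ℂ (prol θ η) (prol θ' η') with hW
  have hWd : ∀ p ∈ U ×ˢ Q, DifferentiableAt ℂ W p := by
    intro p hp
    have : ContDiffAt ℂ 1 W p :=
      (hcX p hp).lieBracket_vectorField (hcY p hp) (by norm_num)
    exact this.differentiableAt (by simp)
  -- Jacobi identity: `[Z_j, W]` lies in the span of the `Z_k`
  have hspan : ∀ p ∈ U ×ˢ Q, ∀ j, ∃ c : Fin (n + 1) → ℂ,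
      ∑ k, c k • Zfield F k p = lieBracket ℂ (Zfield F j) W p := by
    intro p hp j
    rw [← Submodule.mem_span_range_iff_exists_fun]
    have hjac := leibniz_identity_lieBracket (𝕜 := ℂ) (n := (2 : ℕ)) (by simp)
      (hcZ p hp j) (hcX p hp) (hcY p hp)
    rw [hW, hjac]
    have hnear : ∀ᶠ q in 𝓝 p, q ∈ U ×ˢ Q := hS.mem_nhds hp
    have eX : lieBracket ℂ (Zfield F j) (prol θ η)
        =ᶠ[𝓝 p] fun q => ∑ k, Dtot (θ k) j q • Zfield F k q :=
      hnear.mono fun q hq => hXb q hq j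
    have eY : lieBracket ℂ (Zfield F j) (prol θ' η')
        =ᶠ[𝓝 p] fun q => ∑ k, Dtot (θ' k) j q • Zfield F k q :=
      hnear.mono fun q hq => hYb q hq j
    rw [eX.lieBracket_vectorField_eq EventuallyEq.rfl,
      EventuallyEq.rfl.lieBracket_vectorField_eq eY, lieBracket_swap (V := prol θ η)]
    have mX : ∀ k, lieBracket ℂ (Zfield F k) (prol θ η) p
        ∈ Submodule.span ℂ (Set.range fun k => Zfield F k p) := fun k => by
      rw [hXb p hp k]
      exact Submodule.sum_mem _ fun l _ =>
        Submodule.smul_mem _ _ (Submodule.subset_span ⟨l, rfl⟩)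
    have mY : ∀ k, lieBracket ℂ (Zfield F k) (prol θ' η') p
        ∈ Submodule.span ℂ (Set.range fun k => Zfield F k p) := fun k => by
      rw [hYb p hp k]
      exact Submodule.sum_mem _ fun l _ =>
        Submodule.smul_mem _ _ (Submodule.subset_span ⟨l, rfl⟩)
    refine Submodule.add_mem _ ?_ (Submodule.neg_mem _ ?_)
    · exact span_br_left (hZd p hp) (fun k => (Dtot_contDiffAt (N := 1)
        (hcU (hθ k) _ p.1 hp.1) j).differentiableAt (by simp)) mY
    · exact span_br_left (hZd p hp) (fun k => (Dtot_contDiffAt (N := 1)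
        (hcU (hθ' k) _ p.1 hp.1) j).differentiableAt (by simp)) mX
  set θ₂ : Fin (n + 1) → Wsp (n + 1) (m + 1) → ℂ :=
    fun j w => (bracket (toField θ η) (toField θ' η') w).1 j with hθ₂
  set η₂ : Fin (m + 1) → Wsp (n + 1) (m + 1) → ℂ :=
    fun μ w => (bracket (toField θ η) (toField θ' η') w).2 μ with hη₂
  have hW1 : ∀ p ∈ U ×ˢ Q, (W p).1 = bracket (toField θ η) (toField θ' η') p.1 := fun p hp =>
    br_base ((htX p.1 hp.1).differentiableAt (by simp)) ((htY p.1 hp.1).differentiableAt (by simp))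
      ((hcX p hp).differentiableAt (by simp)) ((hcY p hp).differentiableAt (by simp))
  have hθ₂d : ∀ k, ∀ w ∈ U, DifferentiableAt ℂ (θ₂ k) w := fun k w hw =>
    (hB1 k w hw).differentiableAt (hUo.mem_nhds hw)
  have hη₂d : ∀ k, ∀ w ∈ U, DifferentiableAt ℂ (η₂ k) w := fun k w hw =>
    (hB2 k w hw).differentiableAt (hUo.mem_nhds hw)
  have hWx : ∀ p ∈ U ×ˢ Q, ∀ j k, (lieBracket ℂ (Zfield F j) W p).1.1 k = Dtot (θ₂ k) j p := by
    intro p hp j k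
    have e : (fun q => (W q).1.1 k) =ᶠ[𝓝 p] fun q => θ₂ k q.1 := by
      filter_upwards [hS.mem_nhds hp] with q hq
      rw [hW1 q hq]
    rw [br_x F (hZd p hp j) (hWd p hp), e.fderiv_eq, Dtot_eq_s2 F,
      fderiv_base (θ₂ k) p _ (hθ₂d k p.1 hp.1)]
  have hWu : ∀ p ∈ U ×ˢ Q, ∀ j k,
      (lieBracket ℂ (Zfield F j) W p).1.2 k = Dtot (η₂ k) j p - (W p).2 k j := by
    intro p hp j k
    have e : (fun q => (W q).1.2 k) =ᶠ[𝓝 p] fun q => η₂ k q.1 := by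
      filter_upwards [hS.mem_nhds hp] with q hq
      rw [hW1 q hq]
    rw [br_u F (hZd p hp j) (hWd p hp), e.fderiv_eq, Dtot_eq_s2 F,
      fderiv_base (η₂ k) p _ (hη₂d k p.1 hp.1)]
  have hbr : ∀ p ∈ U ×ˢ Q, ∀ j, lieBracket ℂ (Zfield F j) W p
      = ∑ k, Dtot (θ₂ k) j p • Zfield F k p := by
    intro p hp j
    obtain ⟨c, hc⟩ := hspan p hp j
    have : c = fun k => Dtot (θ₂ k) j p := by
      ext k
      rw [← hWx p hp j k, ← hc, sumZ_x]
    rw [← hc, this]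
  -- `W` is the prolongation of the bracket
  have hWprol : ∀ p ∈ U ×ˢ Q, W p = prol θ₂ η₂ p := by
    intro p hp
    refine Prod.ext (hW1 p hp) ?_
    ext μ j
    have h1 := hWu p hp j μ
    rw [hbr p hp j, sumZ_u] at h1
    change (W p).2 μ j = Dtot (η₂ μ) j p - ∑ l, Dtot (θ₂ l) j p * p.2 μ l
    rw [h1]
    ring
  intro p hp
  have e : W =ᶠ[𝓝 p] prol θ₂ η₂ := by
    filter_upwards [hS.mem_nhds hp] with q hq using hWprol q hq
  refine (sym_iff F hFsym (fun k => hθ₂d k p.1 hp.1) (fun k => hη₂d k p.1 hp.1) (hZd p hp)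
    ((hWd p hp).congr_of_eventuallyEq e.symm)).2 fun j => ?_
  rw [← hbr p hp j]
  exact EventuallyEq.rfl.lieBracket_vectorField_eq e.symm
end
end
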